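/- arXiv:2506.14960 — 9 statements merged into one kernel-verified Lean document; each statement's English description precedes it below -/
import Mathlib

section
/- Let U ⊆ ℝ² be an open set with coordinates (x,t) and let f₁₁, f₁₂, f₂₁, f₂₂, f₃₁, f₃₂ : U → ℝ be smooth functions satisfying the pseudospherical structure equations. If φ : U → ℝ is a differentiable function satisfying φ_x = f₃₁ + f₁₁ sin φ + f₂₁ cos φ and φ_t = f₃₂ + f₁₂ sin φ + f₂₂ cos φ on U, then the 1-form (f₁₁ cos φ − f₂₁ sin φ) dx + (f₁₂ cos φ − f₂₂ sin φ) dt is closed, i.e. ∂/∂t (f₁₁ cos φ − f₂₁ sin φ) = ∂/∂x (f₁₂ cos φ − f₂₂ sin φ) at every point of U. -/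
open Real

/-- Partial derivative in the first (`x`) coordinate. -/
noncomputable def pdx (f : ℝ × ℝ → ℝ) : ℝ × ℝ → ℝ := fun p => fderiv ℝ f p (1, 0)

/-- Partial derivative in the second (`t`) coordinate. -/
noncomputable def pdt (f : ℝ × ℝ → ℝ) : ℝ × ℝ → ℝ := fun p => fderiv ℝ f p (0, 1)

/-- The pseudospherical structure equations on `U`. -/
def PSS (f11 f12 f21 f22 f31 f32 : ℝ × ℝ → ℝ) (U : Set (ℝ × ℝ)) : Prop :=
  ∀ p ∈ U,
    pdx f12 p - pdt f11 p = f22 p * f31 p - f21 p * f32 p ∧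
    pdx f22 p - pdt f21 p = f11 p * f32 p - f12 p * f31 p ∧
    pdx f32 p - pdt f31 p = f11 p * f22 p - f12 p * f21 p

theorem statement0 (U : Set (ℝ × ℝ)) (hU : IsOpen U)
    (f11 f12 f21 f22 f31 f32 : ℝ × ℝ → ℝ)
    (hf11 : ContDiffOn ℝ (⊤ : ℕ∞) f11 U) (hf12 : ContDiffOn ℝ (⊤ : ℕ∞) f12 U)
    (hf21 : ContDiffOn ℝ (⊤ : ℕ∞) f21 U) (hf22 : ContDiffOn ℝ (⊤ : ℕ∞) f22 U)
    (hf31 : ContDiffOn ℝ (⊤ : ℕ∞) f31 U) (hf32 : ContDiffOn ℝ (⊤ : ℕ∞) f32 U)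
    (hPSS : PSS f11 f12 f21 f22 f31 f32 U)
    (φ : ℝ × ℝ → ℝ)
    (hφ : ∀ p ∈ U, DifferentiableAt ℝ φ p)
    (hφx : ∀ p ∈ U, pdx φ p = f31 p + f11 p * sin (φ p) + f21 p * cos (φ p))
    (hφt : ∀ p ∈ U, pdt φ p = f32 p + f12 p * sin (φ p) + f22 p * cos (φ p)) :
    ∀ p ∈ U,
      pdt (fun q => f11 q * cos (φ q) - f21 q * sin (φ q)) p =
        pdx (fun q => f12 q * cos (φ q) - f22 q * sin (φ q)) p := by
  intro p hp
  have hd : ∀ f : ℝ × ℝ → ℝ, ContDiffOn ℝ (⊤ : ℕ∞) f U → DifferentiableAt ℝ f p := fun f hf =>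
    (hf.contDiffAt (hU.mem_nhds hp)).differentiableAt (by simp)
  have key : ∀ (f g : ℝ × ℝ → ℝ) (v : ℝ × ℝ), DifferentiableAt ℝ f p → DifferentiableAt ℝ g p →
      fderiv ℝ (fun q => f q * cos (φ q) - g q * sin (φ q)) p v =
        fderiv ℝ f p v * cos (φ p) - fderiv ℝ g p v * sin (φ p)
          - (f p * sin (φ p) + g p * cos (φ p)) * fderiv ℝ φ p v := by
    intro f g v hf hg
    have h := (hφ p hp).hasFDerivAt
    have := ((hf.hasFDerivAt.mul h.cos).sub (hg.hasFDerivAt.mul h.sin)).fderiv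
    have h2 := congrArg (fun L => L v) this
    refine Eq.trans h2 ?_
    simp
    ring
  obtain ⟨h1, h2, -⟩ := hPSS p hp
  have hx := hφx p hp
  have ht := hφt p hp
  unfold pdx pdt at *
  rw [key f11 f21 _ (hd _ hf11) (hd _ hf21), key f12 f22 _ (hd _ hf12) (hd _ hf22), hx, ht]
  linear_combination (-cos (φ p)) * h1 + sin (φ p) * h2
end

section
/- Let U ⊆ ℝ² be an open set with coordinates (x,t) and let f₁₁, f₁₂, f₂₁, f₂₂, f₃₁, f₃₂ : U → ℝ be smooth functions satisfying the pseudospherical structure equations. Then for every point p₀ ∈ U and every φ₀ ∈ ℝ there exist an open neighborhood V ⊆ U of p₀ and a smooth function φ : V → ℝ with φ(p₀) = φ₀ satisfying φ_x = f₃₁ + f₁₁ sin φ + f₂₁ cos φ and φ_t = f₃₂ + f₁₂ sin φ + f₂₂ cos φ on V; moreover, any two such solutions defined on a connected open neighborhood of p₀ that agree at p₀ coincide on that neighborhood. -/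
open Real

/-- The angle system `φ_x = f₃₁ + f₁₁ sin φ + f₂₁ cos φ`,
`φ_t = f₃₂ + f₁₂ sin φ + f₂₂ cos φ` on a set `V`. -/
def AngleSystem (f11 f12 f21 f22 f31 f32 : ℝ × ℝ → ℝ) (φ : ℝ × ℝ → ℝ)
    (V : Set (ℝ × ℝ)) : Prop :=
  ∀ p ∈ V,
    pdx φ p = f31 p + f11 p * sin (φ p) + f21 p * cos (φ p) ∧
    pdt φ p = f32 p + f12 p * sin (φ p) + f22 p * cos (φ p)

section helpers
open Set Filter Topology

lemma unif_diff {F H : Type*} [NormedAddCommGroup F] [NormedSpace ℝ F]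
    [NormedAddCommGroup H] [NormedSpace ℝ H] {f : F → H} {O K : Set F} (hO : IsOpen O)
    (hf : ContDiffOn ℝ 1 f O) (hK : IsCompact K) (hKO : K ⊆ O) {ε : ℝ} (hε : 0 < ε) :
    ∀ᶠ w in 𝓝 (0 : F), ∀ z ∈ K, ‖f (z + w) - f z - fderiv ℝ f z w‖ ≤ ε * ‖w‖ := by
  apply hK.eventually_forall_of_forall_eventually
  intro z₀ hz₀
  have hOz : O ∈ 𝓝 z₀ := hO.mem_nhds (hKO hz₀)
  have h1 := ((hf.contDiffAt hOz).hasStrictFDerivAt one_ne_zero).isLittleO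
  rw [Asymptotics.isLittleO_iff] at h1
  have h1 := h1 (half_pos hε)
  have ht : Tendsto (fun q : F × F => (q.2 + q.1, q.2)) (𝓝 (0, z₀)) (𝓝 (z₀, z₀)) := by
    have : Continuous (fun q : F × F => (q.2 + q.1, q.2)) := by fun_prop
    simpa using this.tendsto (0, z₀)
  have h1 := ht.eventually h1
  have hc : ContinuousAt (fderiv ℝ f) z₀ :=
    (hf.continuousOn_fderiv_of_isOpen hO le_rfl).continuousAt hOz
  have h2 := Metric.continuousAt_iff'.1 hc (ε / 2) (half_pos hε)
  have ht2 : Tendsto (fun q : F × F => q.2) (𝓝 (0, z₀)) (𝓝 z₀) :=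
    continuous_snd.tendsto (0, z₀)
  filter_upwards [h1, ht2.eventually h2] with q hq1 hq2
  simp only [add_sub_cancel_left] at hq1
  rw [dist_eq_norm] at hq2
  have h3 := (fderiv ℝ f q.2 - fderiv ℝ f z₀).le_opNorm q.1
  have h4 : ‖fderiv ℝ f q.2 - fderiv ℝ f z₀‖ * ‖q.1‖ ≤ ε / 2 * ‖q.1‖ := by gcongr
  have e : f (q.2 + q.1) - f q.2 - fderiv ℝ f q.2 q.1 =
    (f (q.2 + q.1) - f q.2 - fderiv ℝ f z₀ q.1) - (fderiv ℝ f q.2 - fderiv ℝ f z₀) q.1 := by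
    simp
  rw [e]
  refine (norm_sub_le _ _).trans ?_
  linarith

section frob
variable {E : Type*} [NormedAddCommGroup E] [NormedSpace ℝ E]

lemma seg_mem {p₀ p : E} {R s : ℝ} (hp : ‖p - p₀‖ < R) (hs : s ∈ Icc (0:ℝ) 1) :
    p₀ + s • (p - p₀) ∈ Metric.closedBall p₀ R := by
  rw [Metric.mem_closedBall, dist_eq_norm, add_sub_cancel_left, norm_smul, Real.norm_eq_abs,
    abs_of_nonneg hs.1]
  nlinarith [hs.2, norm_nonneg (p - p₀)]

lemma lip_seg {G : E × ℝ → E →L[ℝ] ℝ} {p₀ : E} {R K : ℝ} (hK0 : 0 ≤ K) (hR : 0 < R)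
    (hK : ∀ q ∈ Metric.closedBall p₀ R, ∀ y z, ‖G (q, y) - G (q, z)‖ ≤ K * |y - z|)
    {p : E} (hp : ‖p - p₀‖ < R) {s : ℝ} (hs : s ∈ Icc (0:ℝ) 1) :
    LipschitzWith (⟨K * R, by positivity⟩ : NNReal)
      (fun y : ℝ => G (p₀ + s • (p - p₀), y) (p - p₀)) := by
  apply LipschitzWith.of_dist_le_mul
  intro y z
  rw [dist_eq_norm, dist_eq_norm, ← sub_apply]
  refine (ContinuousLinearMap.le_opNorm _ _).trans ?_
  have := hK _ (seg_mem hp hs) y z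
  rw [Real.norm_eq_abs]
  change _ ≤ K * R * |y - z|
  calc _ ≤ (K * |y - z|) * R := by gcongr
    _ = _ := by ring

lemma frob_curve {G : E × ℝ → E →L[ℝ] ℝ} {U : Set E} {p₀ : E} {R K M : ℝ} (hK0 : 0 ≤ K)
    (hR : 0 < R) (hM0 : 0 ≤ M) (hBU : Metric.closedBall p₀ R ⊆ U)
    (hG : ContDiffOn ℝ 1 G (U ×ˢ univ))
    (hM : ∀ q ∈ Metric.closedBall p₀ R, ∀ y, ‖G (q, y)‖ ≤ M)
    (hK : ∀ q ∈ Metric.closedBall p₀ R, ∀ y z, ‖G (q, y) - G (q, z)‖ ≤ K * |y - z|)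
    (φ₀ : ℝ) (p : E) (hp : ‖p - p₀‖ < R) :
    ∃ y : ℝ → ℝ, y 0 = φ₀ ∧ ∀ s ∈ Icc (0:ℝ) 1,
      HasDerivWithinAt y (G (p₀ + s • (p - p₀), y s) (p - p₀)) (Icc 0 1) s := by
  have : IsPicardLindelof (fun s y => G (p₀ + s • (p - p₀), y) (p - p₀))
      (tmin := 0) (tmax := 1) ⟨0, by simp⟩ φ₀ ⟨M * R, by positivity⟩ 0 ⟨M * R, by positivity⟩
      ⟨K * R, by positivity⟩ := by
    refine ⟨fun t ht => (lip_seg hK0 hR hK hp ht).lipschitzOnWith, ?_, ?_, ?_⟩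
    · intro y _
      have : ContinuousOn (fun s : ℝ => G (p₀ + s • (p - p₀), y)) (Icc 0 1) := by
        refine hG.continuousOn.comp (by fun_prop) ?_
        intro s hs
        exact ⟨hBU (seg_mem hp hs), mem_univ _⟩
      exact this.clm_apply continuousOn_const
    · intro s hs y _
      refine (ContinuousLinearMap.le_opNorm _ _).trans ?_
      have := hM _ (seg_mem hp hs) y
      change _ ≤ M * R
      gcongr
    · simp
  exact this.exists_eq_forall_mem_Icc_hasDerivWithinAt₀

lemma ici_of_icc {y : ℝ → ℝ} {y' s : ℝ} (hs : s ∈ Ico (0:ℝ) 1)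
    (h : HasDerivWithinAt y y' (Icc 0 1) s) : HasDerivWithinAt y y' (Ici s) s := by
  refine h.mono_of_mem_nhdsWithin ?_
  exact mem_of_superset (Icc_mem_nhdsGE hs.2) (Icc_subset_Icc_left hs.1)

lemma frob {G : E × ℝ → E →L[ℝ] ℝ} {U : Set E} (hU : IsOpen U) {p₀ : E} {R K M : ℝ} (hK0 : 0 < K)
    (hR : 0 < R) (hM0 : 0 ≤ M) (hBU : Metric.closedBall p₀ R ⊆ U)
    (hG : ContDiffOn ℝ 1 G (U ×ˢ univ))
    (hM : ∀ q ∈ Metric.closedBall p₀ R, ∀ y, ‖G (q, y)‖ ≤ M)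
    (hK : ∀ q ∈ Metric.closedBall p₀ R, ∀ y z, ‖G (q, y) - G (q, z)‖ ≤ K * |y - z|)
    (hsym : ∀ q ∈ U, ∀ y, ∀ v h : E, fderiv ℝ G (q, y) (v, G (q, y) v) h =
      fderiv ℝ G (q, y) (h, G (q, y) h) v)
    (φ₀ : ℝ) :
    ∃ φ : E → ℝ, φ p₀ = φ₀ ∧ ∀ p ∈ Metric.ball p₀ R, HasFDerivAt φ (G (p, φ p)) p := by
  have hex := frob_curve hK0.le hR hM0 hBU hG hM hK φ₀
  choose! Y hY0 hY using hex
  have hO : IsOpen (U ×ˢ (univ : Set ℝ)) := hU.prod isOpen_univ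
  refine ⟨fun p => Y p 1, ?_, ?_⟩
  · have hp : ‖p₀ - p₀‖ < R := by simpa using hR
    rw [← hY0 p₀ hp]
    refine constant_of_has_deriv_right_zero (f := Y p₀) (a := 0) (b := 1)
      (fun s hs => (hY p₀ hp s hs).continuousWithinAt) (fun s hs => ?_) 1 (by simp)
    have := ici_of_icc hs (hY p₀ hp s (Ico_subset_Icc_self hs))
    simpa using this
  intro p hp
  rw [Metric.mem_ball, dist_eq_norm] at hp
  set v := p - p₀ with hv
  set y := Y p with hy
  have hyc : ContinuousOn y (Icc 0 1) := fun s hs => (hY p hp s hs).continuousWithinAt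
  set z : ℝ → E × ℝ := fun s => (p₀ + s • v, y s) with hz
  have hzc : ContinuousOn z (Icc 0 1) := by
    apply ContinuousOn.prodMk (by fun_prop) hyc
  set Z := z '' Icc 0 1 with hZ
  have hZc : IsCompact Z := isCompact_Icc.image_of_continuousOn hzc
  have hzO : ∀ s ∈ Icc (0:ℝ) 1, z s ∈ U ×ˢ (univ : Set ℝ) := fun s hs =>
    ⟨hBU (seg_mem hp hs), mem_univ _⟩
  have hZO : Z ⊆ U ×ˢ univ := by
    rintro _ ⟨s, hs, rfl⟩; exact hzO s hs
  obtain ⟨D, hD⟩ := hZc.exists_bound_of_continuousOn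
    ((hG.continuousOn_fderiv_of_isOpen hO le_rfl).mono hZO)
  have hD0 : 0 ≤ D := (norm_nonneg _).trans (hD (z 0) ⟨0, by simp, rfl⟩)
  rw [hasFDerivAt_iff_isLittleO_nhds_zero, Asymptotics.isLittleO_iff]
  intro ε hε
  set Cg := (Real.exp (K * R) - 1) / (K * R) with hCg
  have hKR : 0 < K * R := by positivity
  have hCg0 : 0 < Cg := by
    apply div_pos _ hKR
    have := Real.add_one_lt_exp hKR.ne'
    linarith
  set η := ε / Cg with hη
  have hη0 : 0 < η := by positivity
  set C := 1 + M with hC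
  have hC0 : 0 < C := by positivity
  have hu := unif_diff hO hG hZc hZO (ε := η / (2 * C * R)) (by positivity)
  obtain ⟨δ, hδ, hu⟩ := Metric.eventually_nhds_iff.1 hu
  have ev1 : ∀ᶠ h in 𝓝 (0:E), C * ‖h‖ < δ := by
    have : Continuous (fun h : E => C * ‖h‖) := by fun_prop
    exact this.continuousAt.eventually_lt_const (by simpa using hδ)
  have ev2 : ∀ᶠ h in 𝓝 (0:E), D * C * ‖h‖ < η / 2 := by
    have : Continuous (fun h : E => D * C * ‖h‖) := by fun_prop
    exact this.continuousAt.eventually_lt_const (by simpa using hη0)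
  have ev3 : ∀ᶠ h in 𝓝 (0:E), ‖v + h‖ < R := by
    have : Continuous (fun h : E => ‖v + h‖) := by fun_prop
    exact this.continuousAt.eventually_lt_const (by simpa using hp)
  filter_upwards [ev1, ev2, ev3] with h h1 h2 h3
  have hph : p + h - p₀ = v + h := by rw [hv]; abel
  have hp' : ‖p + h - p₀‖ < R := by rw [hph]; exact h3
  set ψ : ℝ → ℝ := fun s => y s + s * G (z s) h with hψ
  set ψ' : ℝ → ℝ := fun s => G (z s) v + (G (z s) h + s * fderiv ℝ G (z s) (v, G (z s) v) h)
    with hψ'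
  have hψd : ∀ s ∈ Icc (0:ℝ) 1, HasDerivWithinAt ψ (ψ' s) (Icc 0 1) s := by
    intro s hs
    have d1 : HasDerivWithinAt z (v, G (z s) v) (Icc 0 1) s := by
      refine HasDerivWithinAt.prodMk ?_ (hY p hp s hs)
      have : HasDerivAt (fun s : ℝ => p₀ + s • v) ((1:ℝ) • v) s :=
        ((hasDerivAt_id s).smul_const v).const_add p₀
      simpa using this.hasDerivWithinAt
    have d2 : HasFDerivAt G (fderiv ℝ G (z s)) (z s) :=
      ((hG.contDiffAt (hO.mem_nhds (hzO s hs))).differentiableAt one_ne_zero).hasFDerivAt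
    have d3 := (d2.comp_hasDerivWithinAt s d1).clm_apply (hasDerivWithinAt_const s (Icc 0 1) h)
    have d4 := (hY p hp s hs).add ((hasDerivWithinAt_id s (Icc 0 1)).mul d3)
    refine d4.congr_deriv ?_
    simp [hψ', hz, hv, hy]
  set e := η * ‖h‖ with he
  have key := dist_le_of_approx_trajectories_ODE_of_mem (a := 0) (b := 1)
    (v := fun s y => G (p₀ + s • (p + h - p₀), y) (p + h - p₀)) (s := fun _ => univ)
    (f := Y (p + h)) (f' := fun s => G (p₀ + s • (p + h - p₀), Y (p + h) s) (p + h - p₀))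
    (g := ψ) (g' := ψ') (εf := 0) (εg := e) (δ := 0)
    (fun t ht => (lip_seg hK0.le hR hK hp' (Ico_subset_Icc_self ht)).lipschitzOnWith)
    (fun s hs => (hY (p + h) hp' s hs).continuousWithinAt)
    (fun s hs => ici_of_icc hs (hY (p + h) hp' s (Ico_subset_Icc_self hs)))
    (fun s hs => by simp) (fun _ _ => mem_univ _)
    (fun s hs => (hψd s hs).continuousWithinAt)
    (fun s hs => ici_of_icc hs (hψd s (Ico_subset_Icc_self hs)))
    ?_ (fun _ _ => mem_univ _) ?_ 1 (by simp)
  · rw [gronwallBound_of_K_ne_0 (by exact hKR.ne')] at key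
    have hz1 : z 1 = (p, y 1) := by simp [hz, hv]
    rw [dist_eq_norm] at key
    have e1 : Y (p + h) 1 - Y p 1 - (G (p, Y p 1)) h = Y (p + h) 1 - ψ 1 := by
      simp only [hψ, hz1]; ring
    rw [e1]
    refine key.trans (le_of_eq ?_)
    change 0 * _ + (0 + e) / (K * R) * (Real.exp (K * R * (1 - 0)) - 1) = _
    have : ε = η * Cg := by rw [hη]; field_simp
    rw [this, he, hCg]
    simp only [sub_zero, mul_one]
    ring
  · intro s hs
    have hs' := Ico_subset_Icc_self hs
    rw [hph]
    set w : E × ℝ := s • (h, G (z s) h) with hw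
    have hzw : (p₀ + s • (v + h), ψ s) = z s + w := by
      simp only [hz, hw, hψ, Prod.smul_mk, Prod.mk_add_mk, smul_eq_mul, smul_add, add_assoc]
    have hnorm : ‖((h, G (z s) h) : E × ℝ)‖ ≤ C * ‖h‖ := by
      rw [Prod.norm_def]
      have hb : ‖G (z s) h‖ ≤ M * ‖h‖ :=
        (ContinuousLinearMap.le_opNorm _ _).trans (by
          have := hM _ (seg_mem hp hs') (y s)
          gcongr)
      have := norm_nonneg h
      apply max_le
      · simp only [hC]; nlinarith
      · simp only [hC]; nlinarith
    have hwn : ‖w‖ ≤ C * ‖h‖ := by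
      rw [hw, norm_smul, Real.norm_eq_abs, abs_of_nonneg hs.1]
      nlinarith [hs.2, norm_nonneg ((h, G (z s) h) : E × ℝ)]
    have hrem := hu (y := w) (by rw [dist_zero_right]; linarith) (z s) ⟨s, hs', rfl⟩
    have hDz := hD (z s) ⟨s, hs', rfl⟩
    rw [dist_comm, dist_eq_norm, hzw]
    have hs3 := hsym _ (hBU (seg_mem hp hs')) (y s) v h
    change fderiv ℝ G (z s) (v, G (z s) v) h = fderiv ℝ G (z s) (h, G (z s) h) v at hs3
    have hdec : G (z s + w) (v + h) - ψ' s =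
        (G (z s + w) - G (z s) - fderiv ℝ G (z s) w) (v + h) + fderiv ℝ G (z s) w h := by
      simp only [hψ', hs3, hw, map_smul, map_add, sub_apply,
        smul_apply, smul_eq_mul]
      ring
    rw [hdec]
    have b1 : ‖(G (z s + w) - G (z s) - fderiv ℝ G (z s) w) (v + h)‖
        ≤ η / (2 * C * R) * (C * ‖h‖) * R := by
      refine (ContinuousLinearMap.le_opNorm _ _).trans ?_
      have : ‖G (z s + w) - G (z s) - fderiv ℝ G (z s) w‖ ≤ η / (2 * C * R) * (C * ‖h‖) :=
        hrem.trans (by gcongr)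
      gcongr
    have b1' : η / (2 * C * R) * (C * ‖h‖) * R = η / 2 * ‖h‖ := by field_simp
    have b2 : ‖fderiv ℝ G (z s) w h‖ ≤ D * (C * ‖h‖) * ‖h‖ := by
      refine (ContinuousLinearMap.le_opNorm _ _).trans ?_
      have : ‖fderiv ℝ G (z s) w‖ ≤ D * (C * ‖h‖) :=
        (ContinuousLinearMap.le_opNorm _ _).trans (by gcongr)
      gcongr
    have b3 : D * (C * ‖h‖) * ‖h‖ ≤ η / 2 * ‖h‖ := by
      rw [← mul_assoc]; gcongr
    refine (norm_add_le _ _).trans ?_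
    rw [he]; linarith
  · simp [hψ, hy, hY0 p hp, hY0 (p + h) hp']

lemma smooth_of_frob {G : E × ℝ → E →L[ℝ] ℝ} {U V : Set E} (hV : IsOpen V) (hVU : V ⊆ U)
    (hG : ContDiffOn ℝ (⊤ : ℕ∞) G (U ×ˢ univ)) {φ : E → ℝ}
    (hφ : ∀ p ∈ V, HasFDerivAt φ (G (p, φ p)) p) : ContDiffOn ℝ (⊤ : ℕ∞) φ V := by
  rw [contDiffOn_infty]
  intro n
  have hd : DifferentiableOn ℝ φ V := fun p hp => (hφ p hp).differentiableAt.differentiableWithinAt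
  induction n with
  | zero => exact contDiffOn_zero.2 hd.continuousOn
  | succ n ih =>
    have := contDiffOn_succ_iff_fderiv_of_isOpen (𝕜 := ℝ) (f := φ) (n := (n : WithTop ℕ∞)) hV
    push_cast
    rw [this]
    refine ⟨hd, by simp, ?_⟩
    have hc : ContDiffOn ℝ n (fun p => G (p, φ p)) V :=
      ((contDiffOn_infty.1 hG) n).comp (contDiffOn_id.prodMk ih) (fun p hp => ⟨hVU hp, mem_univ _⟩)
    exact hc.congr (fun p hp => (hφ p hp).fderiv)

lemma frob_unique {G : E × ℝ → E →L[ℝ] ℝ} {W : Set E} (hWc : IsPreconnected W)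
    (hK : ∀ q ∈ W, ∃ R > 0, ∃ K ≥ 0, Metric.closedBall q R ⊆ W ∧
      ∀ p ∈ Metric.closedBall q R, ∀ y z, ‖G (p, y) - G (p, z)‖ ≤ K * |y - z|)
    {φ ψ : E → ℝ} (hφ : ∀ p ∈ W, HasFDerivAt φ (G (p, φ p)) p)
    (hψ : ∀ p ∈ W, HasFDerivAt ψ (G (p, ψ p)) p) {p₀ : E} (hp₀ : p₀ ∈ W) (h0 : φ p₀ = ψ p₀) :
    EqOn φ ψ W := by
  have hloc : ∀ q ∈ W, φ q = ψ q → ∀ᶠ p in 𝓝 q, p ∈ W ∧ φ p = ψ p := by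
    intro q hq he
    obtain ⟨R, hR, K, hK0, hB, hL⟩ := hK q hq
    filter_upwards [Metric.ball_mem_nhds q hR] with p hp
    refine ⟨hB (Metric.ball_subset_closedBall hp), ?_⟩
    rw [Metric.mem_ball, dist_eq_norm] at hp
    have hd : ∀ χ : E → ℝ, (∀ p ∈ W, HasFDerivAt χ (G (p, χ p)) p) → ∀ s ∈ Icc (0:ℝ) 1,
        HasDerivAt (fun s : ℝ => χ (q + s • (p - q)))
          (G (q + s • (p - q), χ (q + s • (p - q))) (p - q)) s := by
      intro χ hχ s hs
      have d1 : HasDerivAt (fun s : ℝ => q + s • (p - q)) (p - q) s := by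
        have : HasDerivAt (fun s : ℝ => q + s • (p - q)) ((1:ℝ) • (p - q)) s :=
          ((hasDerivAt_id s).smul_const (p - q)).const_add q
        simpa using this
      exact (hχ _ (hB (seg_mem hp hs))).comp_hasDerivAt s d1
    have := ODE_solution_unique_of_mem_Icc_right (a := 0) (b := 1)
      (v := fun s y => G (q + s • (p - q), y) (p - q)) (s := fun _ => univ)
      (f := fun s : ℝ => φ (q + s • (p - q))) (g := fun s : ℝ => ψ (q + s • (p - q)))
      (fun t ht => (lip_seg hK0 hR hL hp (Ico_subset_Icc_self ht)).lipschitzOnWith)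
      (fun s hs => (hd φ hφ s hs).continuousAt.continuousWithinAt)
      (fun s hs => (hd φ hφ s (Ico_subset_Icc_self hs)).hasDerivWithinAt)
      (fun _ _ => mem_univ _)
      (fun s hs => (hd ψ hψ s hs).continuousAt.continuousWithinAt)
      (fun s hs => (hd ψ hψ s (Ico_subset_Icc_self hs)).hasDerivWithinAt)
      (fun _ _ => mem_univ _) (by simpa using he) (show (1:ℝ) ∈ Icc 0 1 by simp)
    simpa using this
  have hsub : W ⊆ {p | p ∈ W ∧ φ p = ψ p} := by
    apply hWc.subset_of_closure_inter_subset
    · rw [isOpen_iff_mem_nhds]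
      rintro q ⟨hq, he⟩
      exact hloc q hq he
    · exact ⟨p₀, hp₀, hp₀, h0⟩
    · rintro q ⟨hq, hqW⟩
      refine ⟨hqW, ?_⟩
      have hc : ContinuousAt (fun p => φ p - ψ p) q :=
        (hφ q hqW).continuousAt.sub (hψ q hqW).continuousAt
      by_contra hne
      have : ∀ᶠ p in 𝓝 q, φ p - ψ p ≠ 0 := hc.eventually_ne (sub_ne_zero.2 hne)
      obtain ⟨p, hp1, hp2⟩ := ((mem_closure_iff_frequently.1 hq).and_eventually this).exists
      exact hp2 (sub_eq_zero.2 hp1.2)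
  intro p hp
  exact (hsub hp).2

end frob

noncomputable def angA (g1 g2 g3 : ℝ × ℝ → ℝ) : (ℝ × ℝ) × ℝ → ℝ :=
  fun z => g3 z.1 + g1 z.1 * Real.sin z.2 + g2 z.1 * Real.cos z.2

noncomputable def angG (f11 f12 f21 f22 f31 f32 : ℝ × ℝ → ℝ) :
    (ℝ × ℝ) × ℝ → (ℝ × ℝ) →L[ℝ] ℝ :=
  fun z => angA f11 f21 f31 z • ContinuousLinearMap.fst ℝ ℝ ℝ +
    angA f12 f22 f32 z • ContinuousLinearMap.snd ℝ ℝ ℝ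

lemma angA_smooth {U : Set (ℝ × ℝ)} {g1 g2 g3 : ℝ × ℝ → ℝ}
    (h1 : ContDiffOn ℝ (⊤ : ℕ∞) g1 U) (h2 : ContDiffOn ℝ (⊤ : ℕ∞) g2 U)
    (h3 : ContDiffOn ℝ (⊤ : ℕ∞) g3 U) :
    ContDiffOn ℝ (⊤ : ℕ∞) (angA g1 g2 g3) (U ×ˢ univ) := by
  have hm : MapsTo (Prod.fst : (ℝ × ℝ) × ℝ → ℝ × ℝ) (U ×ˢ univ) U := fun z hz => hz.1
  have c1 := h1.comp contDiffOn_fst hm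
  have c2 := h2.comp contDiffOn_fst hm
  have c3 := h3.comp contDiffOn_fst hm
  have s : ContDiffOn ℝ (⊤ : ℕ∞) (fun z : (ℝ × ℝ) × ℝ => Real.sin z.2) (U ×ˢ univ) :=
    (Real.contDiff_sin.comp contDiff_snd).contDiffOn
  have c : ContDiffOn ℝ (⊤ : ℕ∞) (fun z : (ℝ × ℝ) × ℝ => Real.cos z.2) (U ×ˢ univ) :=
    (Real.contDiff_cos.comp contDiff_snd).contDiffOn
  exact (c3.add (c1.mul s)).add (c2.mul c)

lemma pd_apply {f : ℝ × ℝ → ℝ} (p v : ℝ × ℝ) :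
    fderiv ℝ f p v = v.1 * pdx f p + v.2 * pdt f p := by
  have : v = v.1 • ((1, 0) : ℝ × ℝ) + v.2 • ((0, 1) : ℝ × ℝ) := by ext <;> simp
  conv_lhs => rw [this]
  simp only [map_add, map_smul, smul_eq_mul, pdx, pdt]

lemma angA_fderiv {g1 g2 g3 : ℝ × ℝ → ℝ} {q : ℝ × ℝ} (y : ℝ)
    (h1 : DifferentiableAt ℝ g1 q) (h2 : DifferentiableAt ℝ g2 q)
    (h3 : DifferentiableAt ℝ g3 q) (v : ℝ × ℝ) (c : ℝ) :
    fderiv ℝ (angA g1 g2 g3) (q, y) (v, c) =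
      (v.1 * pdx g3 q + v.2 * pdt g3 q) + (v.1 * pdx g1 q + v.2 * pdt g1 q) * Real.sin y
        + (v.1 * pdx g2 q + v.2 * pdt g2 q) * Real.cos y
        + (g1 q * Real.cos y - g2 q * Real.sin y) * c := by
  have hf : HasFDerivAt (Prod.fst : (ℝ × ℝ) × ℝ → ℝ × ℝ) (ContinuousLinearMap.fst ℝ (ℝ × ℝ) ℝ)
    (q, y) := hasFDerivAt_fst
  have hs : HasFDerivAt (Prod.snd : (ℝ × ℝ) × ℝ → ℝ) (ContinuousLinearMap.snd ℝ (ℝ × ℝ) ℝ)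
    (q, y) := hasFDerivAt_snd
  have c1 : HasFDerivAt (fun z : (ℝ × ℝ) × ℝ => g1 z.1) _ (q, y) :=
    HasFDerivAt.comp (q, y) (g := g1) h1.hasFDerivAt hf
  have c2 : HasFDerivAt (fun z : (ℝ × ℝ) × ℝ => g2 z.1) _ (q, y) :=
    HasFDerivAt.comp (q, y) (g := g2) h2.hasFDerivAt hf
  have c3 : HasFDerivAt (fun z : (ℝ × ℝ) × ℝ => g3 z.1) _ (q, y) :=
    HasFDerivAt.comp (q, y) (g := g3) h3.hasFDerivAt hf
  have key : HasFDerivAt (angA g1 g2 g3) _ (q, y) := (c3.add (c1.mul hs.sin)).add (c2.mul hs.cos)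
  rw [key.fderiv]
  simp [pd_apply]
  ring

lemma ang_bounds {U : Set (ℝ × ℝ)} (hU : IsOpen U) {f11 f12 f21 f22 f31 f32 : ℝ × ℝ → ℝ}
    (hf11 : ContinuousOn f11 U) (hf12 : ContinuousOn f12 U)
    (hf21 : ContinuousOn f21 U) (hf22 : ContinuousOn f22 U)
    (hf31 : ContinuousOn f31 U) (hf32 : ContinuousOn f32 U) {q : ℝ × ℝ} (hq : q ∈ U) :
    ∃ R > 0, ∃ K > 0, Metric.closedBall q R ⊆ U ∧
      (∀ p ∈ Metric.closedBall q R, ∀ y, ‖angG f11 f12 f21 f22 f31 f32 (p, y)‖ ≤ K) ∧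
      ∀ p ∈ Metric.closedBall q R, ∀ y z, ‖angG f11 f12 f21 f22 f31 f32 (p, y) -
        angG f11 f12 f21 f22 f31 f32 (p, z)‖ ≤ K * |y - z| := by
  obtain ⟨R, hR, hB⟩ := Metric.nhds_basis_closedBall.mem_iff.1 (hU.mem_nhds hq)
  obtain ⟨M, hM⟩ := (isCompact_closedBall q R).exists_bound_of_continuousOn
    (f := fun p => |f11 p| + |f12 p| + |f21 p| + |f22 p| + |f31 p| + |f32 p|)
    ((((((hf11.abs.add hf12.abs).add hf21.abs).add hf22.abs).add hf31.abs).add hf32.abs).mono hB)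
  have hM0 : 0 ≤ M := (norm_nonneg _).trans (hM q (Metric.mem_closedBall_self hR.le))
  have hn : ∀ a b : ℝ, ‖a • ContinuousLinearMap.fst ℝ ℝ ℝ + b • ContinuousLinearMap.snd ℝ ℝ ℝ‖
      ≤ |a| + |b| := by
    intro a b
    refine (norm_add_le _ _).trans ?_
    rw [norm_smul, norm_smul, Real.norm_eq_abs, Real.norm_eq_abs]
    have := ContinuousLinearMap.norm_fst_le ℝ ℝ ℝ
    have := ContinuousLinearMap.norm_snd_le ℝ ℝ ℝ
    nlinarith [abs_nonneg a, abs_nonneg b]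
  refine ⟨R, hR, M + 1, by positivity, hB, ?_, ?_⟩
  · intro p hp y
    have h := hM p hp
    rw [Real.norm_eq_abs, abs_of_nonneg (by positivity)] at h
    refine (hn _ _).trans ?_
    have hA : ∀ g1 g2 g3 : ℝ × ℝ → ℝ, |angA g1 g2 g3 (p, y)| ≤ |g1 p| + |g2 p| + |g3 p| := by
      intro g1 g2 g3
      have e1 : |g1 p * Real.sin y| ≤ |g1 p| := by
        rw [abs_mul]; exact mul_le_of_le_one_right (abs_nonneg _) (Real.abs_sin_le_one y)
      have e2 : |g2 p * Real.cos y| ≤ |g2 p| := by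
        rw [abs_mul]; exact mul_le_of_le_one_right (abs_nonneg _) (Real.abs_cos_le_one y)
      have := abs_add_three (g3 p) (g1 p * Real.sin y) (g2 p * Real.cos y)
      simp only [angA]
      linarith
    have := hA f11 f21 f31
    have := hA f12 f22 f32
    linarith
  · intro p hp y z
    have h := hM p hp
    rw [Real.norm_eq_abs, abs_of_nonneg (by positivity)] at h
    have e : angG f11 f12 f21 f22 f31 f32 (p, y) - angG f11 f12 f21 f22 f31 f32 (p, z) =
      (angA f11 f21 f31 (p, y) - angA f11 f21 f31 (p, z)) • ContinuousLinearMap.fst ℝ ℝ ℝ +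
      (angA f12 f22 f32 (p, y) - angA f12 f22 f32 (p, z)) • ContinuousLinearMap.snd ℝ ℝ ℝ := by
      simp only [angG]; module
    rw [e]
    refine (hn _ _).trans ?_
    have hA : ∀ g1 g2 g3 : ℝ × ℝ → ℝ, |angA g1 g2 g3 (p, y) - angA g1 g2 g3 (p, z)| ≤
        (|g1 p| + |g2 p|) * |y - z| := by
      intro g1 g2 g3
      have e : angA g1 g2 g3 (p, y) - angA g1 g2 g3 (p, z) =
        g1 p * (Real.sin y - Real.sin z) + g2 p * (Real.cos y - Real.cos z) := by
        simp only [angA]; ring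
      rw [e]
      refine (abs_add_le _ _).trans ?_
      rw [abs_mul, abs_mul, add_mul]
      have := Real.abs_sin_sub_sin_le y z
      have := Real.abs_cos_sub_cos_le y z
      gcongr
    have h1 := hA f11 f21 f31
    have h2 := hA f12 f22 f32
    have h3 : (|f11 p| + |f21 p| + (|f12 p| + |f22 p|)) * |y - z| ≤ (M + 1) * |y - z| := by
      apply mul_le_mul_of_nonneg_right _ (abs_nonneg _)
      have := abs_nonneg (f31 p)
      have := abs_nonneg (f32 p)
      linarith
    linarith

lemma ang_sym {U : Set (ℝ × ℝ)} {f11 f12 f21 f22 f31 f32 : ℝ × ℝ → ℝ}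
    (hPSS : PSS f11 f12 f21 f22 f31 f32 U) {q : ℝ × ℝ} (hq : q ∈ U)
    (h11 : DifferentiableAt ℝ f11 q) (h12 : DifferentiableAt ℝ f12 q)
    (h21 : DifferentiableAt ℝ f21 q) (h22 : DifferentiableAt ℝ f22 q)
    (h31 : DifferentiableAt ℝ f31 q) (h32 : DifferentiableAt ℝ f32 q) (y : ℝ)
    (hA : DifferentiableAt ℝ (angA f11 f21 f31) (q, y))
    (hB : DifferentiableAt ℝ (angA f12 f22 f32) (q, y)) (v h : ℝ × ℝ) :
    fderiv ℝ (angG f11 f12 f21 f22 f31 f32) (q, y) (v, angG f11 f12 f21 f22 f31 f32 (q, y) v) h =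
    fderiv ℝ (angG f11 f12 f21 f22 f31 f32) (q, y) (h, angG f11 f12 f21 f22 f31 f32 (q, y) h) v := by
  have key : HasFDerivAt (angG f11 f12 f21 f22 f31 f32) _ (q, y) :=
    (hA.hasFDerivAt.smul_const (ContinuousLinearMap.fst ℝ ℝ ℝ)).add
      (hB.hasFDerivAt.smul_const (ContinuousLinearMap.snd ℝ ℝ ℝ))
  have hap : ∀ (u k : ℝ × ℝ) (c : ℝ), fderiv ℝ (angG f11 f12 f21 f22 f31 f32) (q, y) (u, c) k =
      fderiv ℝ (angA f11 f21 f31) (q, y) (u, c) * k.1 +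
      fderiv ℝ (angA f12 f22 f32) (q, y) (u, c) * k.2 := by
    intro u k c
    rw [key.fderiv]
    simp
  have hGv : ∀ u : ℝ × ℝ, angG f11 f12 f21 f22 f31 f32 (q, y) u =
      (f31 q + f11 q * Real.sin y + f21 q * Real.cos y) * u.1 +
      (f32 q + f12 q * Real.sin y + f22 q * Real.cos y) * u.2 := by
    intro u; simp [angG, angA]
  rw [hap, hap, angA_fderiv y h11 h21 h31, angA_fderiv y h12 h22 h32, angA_fderiv y h11 h21 h31,
    angA_fderiv y h12 h22 h32, hGv, hGv]
  obtain ⟨e1, e2, e3⟩ := hPSS q hq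
  have sc := Real.sin_sq_add_cos_sq y
  linear_combination (v.1 * h.2 - v.2 * h.1) * (e3 + Real.sin y * e1 + Real.cos y * e2
    - (f11 q * f22 q - f12 q * f21 q) * sc)

lemma ang_deriv {V : Set (ℝ × ℝ)} {f11 f12 f21 f22 f31 f32 φ : ℝ × ℝ → ℝ} (hV : IsOpen V)
    (hφ : ContDiffOn ℝ (⊤ : ℕ∞) φ V) (hA : AngleSystem f11 f12 f21 f22 f31 f32 φ V) :
    ∀ p ∈ V, HasFDerivAt φ (angG f11 f12 f21 f22 f31 f32 (p, φ p)) p := by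
  intro p hp
  have hd : DifferentiableAt ℝ φ p :=
    (hφ.contDiffAt (hV.mem_nhds hp)).differentiableAt (by simp)
  have : angG f11 f12 f21 f22 f31 f32 (p, φ p) = fderiv ℝ φ p := by
    refine ContinuousLinearMap.ext fun v => ?_
    rw [pd_apply, (hA p hp).1, (hA p hp).2]
    simp only [angG, angA, add_apply, smul_apply, ContinuousLinearMap.coe_fst',
      ContinuousLinearMap.coe_snd', smul_eq_mul]
    ring
  rw [this]
  exact hd.hasFDerivAt

end helpers

theorem statement1 (U : Set (ℝ × ℝ)) (hU : IsOpen U)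
    (f11 f12 f21 f22 f31 f32 : ℝ × ℝ → ℝ)
    (hf11 : ContDiffOn ℝ (⊤ : ℕ∞) f11 U) (hf12 : ContDiffOn ℝ (⊤ : ℕ∞) f12 U)
    (hf21 : ContDiffOn ℝ (⊤ : ℕ∞) f21 U) (hf22 : ContDiffOn ℝ (⊤ : ℕ∞) f22 U)
    (hf31 : ContDiffOn ℝ (⊤ : ℕ∞) f31 U) (hf32 : ContDiffOn ℝ (⊤ : ℕ∞) f32 U)
    (hPSS : PSS f11 f12 f21 f22 f31 f32 U) :
    ∀ p₀ ∈ U, ∀ φ₀ : ℝ,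
      (∃ V : Set (ℝ × ℝ), IsOpen V ∧ p₀ ∈ V ∧ V ⊆ U ∧
        ∃ φ : ℝ × ℝ → ℝ, ContDiffOn ℝ (⊤ : ℕ∞) φ V ∧ φ p₀ = φ₀ ∧
          AngleSystem f11 f12 f21 f22 f31 f32 φ V) ∧
      (∀ W : Set (ℝ × ℝ), IsOpen W → IsConnected W → p₀ ∈ W → W ⊆ U →
        ∀ φ ψ : ℝ × ℝ → ℝ,
          ContDiffOn ℝ (⊤ : ℕ∞) φ W → AngleSystem f11 f12 f21 f22 f31 f32 φ W →
          ContDiffOn ℝ (⊤ : ℕ∞) ψ W → AngleSystem f11 f12 f21 f22 f31 f32 ψ W →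
          φ p₀ = ψ p₀ → Set.EqOn φ ψ W) := by
  intro p₀ hp₀ φ₀
  have hGs : ContDiffOn ℝ (⊤ : ℕ∞) (angG f11 f12 f21 f22 f31 f32) (U ×ˢ Set.univ) :=
    ((angA_smooth hf11 hf21 hf31).smul contDiffOn_const).add
      ((angA_smooth hf12 hf22 hf32).smul contDiffOn_const)
  have hO : IsOpen (U ×ˢ (Set.univ : Set ℝ)) := hU.prod isOpen_univ
  constructor
  · obtain ⟨R, hR, K, hK0, hB, hM, hK⟩ := ang_bounds hU hf11.continuousOn hf12.continuousOn
      hf21.continuousOn hf22.continuousOn hf31.continuousOn hf32.continuousOn hp₀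
    have hd : ∀ {f : ℝ × ℝ → ℝ}, ContDiffOn ℝ (⊤ : ℕ∞) f U → ∀ q ∈ U, DifferentiableAt ℝ f q :=
      fun hf q hq => (hf.contDiffAt (hU.mem_nhds hq)).differentiableAt (by simp)
    have hd' : ∀ {f : (ℝ × ℝ) × ℝ → ℝ}, ContDiffOn ℝ (⊤ : ℕ∞) f (U ×ˢ Set.univ) → ∀ q ∈ U, ∀ y,
        DifferentiableAt ℝ f (q, y) :=
      fun hf q hq y => (hf.contDiffAt (hO.mem_nhds ⟨hq, Set.mem_univ _⟩)).differentiableAt (by simp)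
    obtain ⟨φ, h0, hφ⟩ := frob hU hK0 hR hK0.le hB (hGs.of_le (by exact_mod_cast le_top)) hM hK
      (fun q hq y v h => ang_sym hPSS hq (hd hf11 q hq) (hd hf12 q hq) (hd hf21 q hq)
        (hd hf22 q hq) (hd hf31 q hq) (hd hf32 q hq) y
        (hd' (angA_smooth hf11 hf21 hf31) q hq y) (hd' (angA_smooth hf12 hf22 hf32) q hq y) v h) φ₀
    have hVU : Metric.ball p₀ R ⊆ U := Metric.ball_subset_closedBall.trans hB
    refine ⟨Metric.ball p₀ R, Metric.isOpen_ball, Metric.mem_ball_self hR, hVU, φ,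
      smooth_of_frob Metric.isOpen_ball hVU hGs hφ, h0, ?_⟩
    intro p hp
    simp [pdx, pdt, (hφ p hp).fderiv, angG, angA]
  · intro W hW hWc hpW hWU φ ψ hφ hφA hψ hψA h0
    refine frob_unique hWc.isPreconnected ?_ (ang_deriv hW hφ hφA) (ang_deriv hW hψ hψA) hpW h0
    intro q hq
    obtain ⟨R, hR, K, hK0, hB, -, hK⟩ := ang_bounds hW (hf11.continuousOn.mono hWU)
      (hf12.continuousOn.mono hWU) (hf21.continuousOn.mono hWU) (hf22.continuousOn.mono hWU)
      (hf31.continuousOn.mono hWU) (hf32.continuousOn.mono hWU) hq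
    exact ⟨R, hR, K, hK0.le, hB, hK⟩
end

section
/- Let m ∈ ℝ, let U ⊆ ℝ² be open with coordinates (x,t), and let u : U → ℝ be a smooth solution of the Camassa–Holm equation u_t − u_xxt = u u_xxx + 2 u_x u_xx − 3 u u_x − m u_x on U; set h = u − u_xx + m/2. Then for every p₀ ∈ U and every c ∈ ℝ there exist an open neighborhood V ⊆ U of p₀ and a smooth φ₀ : V → ℝ with φ₀(p₀) = c satisfying the system ∂φ₀/∂x = (h − 1) sin φ₀ + h and ∂φ₀/∂t = u_x cos φ₀ − (uh + m/2 − 1) sin φ₀ − u(h + 1) − m/2 on V; moreover, any two such solutions on a connected open neighborhood of p₀ agreeing at p₀ coincide. -/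
open Real

/-- `h = u - u_xx + m/2`. -/
noncomputable def chH (m : ℝ) (u : ℝ × ℝ → ℝ) : ℝ × ℝ → ℝ :=
  fun p => u p - pdx (pdx u) p + m / 2

/-- The Camassa–Holm equation `u_t - u_xxt = u u_xxx + 2 u_x u_xx - 3 u u_x - m u_x` at `p`. -/
def CamassaHolm (m : ℝ) (u : ℝ × ℝ → ℝ) (p : ℝ × ℝ) : Prop :=
  pdt u p - pdt (pdx (pdx u)) p =
    u p * pdx (pdx (pdx u)) p + 2 * pdx u p * pdx (pdx u) p - 3 * u p * pdx u p - m * pdx u p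

/-- The system for `φ₀` associated to the Camassa–Holm equation, on a set `V`. -/
def CHAngleSystem (m : ℝ) (u φ₀ : ℝ × ℝ → ℝ) (V : Set (ℝ × ℝ)) : Prop :=
  ∀ p ∈ V,
    pdx φ₀ p = (chH m u p - 1) * sin (φ₀ p) + chH m u p ∧
    pdt φ₀ p = pdx u p * cos (φ₀ p) - (u p * chH m u p + m / 2 - 1) * sin (φ₀ p)
      - u p * (chH m u p + 1) - m / 2

section CHHelpers
open Set Metric Filter Topology

theorem frob_consts {E : Type*} [NormedAddCommGroup E] [NormedSpace ℝ E]
    (W : E × ℝ → E →L[ℝ] ℝ) (Ω : Set (E × ℝ)) (hΩ : IsOpen Ω) (hW : ContDiffOn ℝ 2 W Ω)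
    (z₀ : E × ℝ) (hz₀ : z₀ ∈ Ω) :
    ∃ (R : ℝ) (K L : NNReal) (M : ℝ), 0 < R ∧ 0 < M ∧ closedBall z₀ R ⊆ Ω ∧
      LipschitzOnWith K W (closedBall z₀ R) ∧ LipschitzOnWith L (fderiv ℝ W) (closedBall z₀ R) ∧
      (∀ z ∈ closedBall z₀ R, ‖W z‖ ≤ M ∧ ‖fderiv ℝ W z‖ ≤ M) := by
  have h2 : ContDiffAt ℝ 2 W z₀ := hW.contDiffAt (hΩ.mem_nhds hz₀)
  have h1 : ContDiffAt ℝ 1 (fderiv ℝ W) z₀ := h2.fderiv_right (by norm_num)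
  obtain ⟨K, s, hs, hK⟩ := (h2.of_le (by norm_num)).exists_lipschitzOnWith
  obtain ⟨L, t, ht, hL⟩ := h1.exists_lipschitzOnWith
  have hb1 : ∀ᶠ z in 𝓝 z₀, ‖W z‖ < ‖W z₀‖ + 1 :=
    h2.continuousAt.norm.eventually_lt continuousAt_const (lt_add_one _)
  obtain ⟨R, hR, hsub⟩ := nhds_basis_closedBall.mem_iff.1
    (inter_mem (inter_mem (inter_mem hs ht) hb1) (hΩ.mem_nhds hz₀))
  refine ⟨R, K, L, ‖W z₀‖ + ‖fderiv ℝ W z₀‖ + L * R + 1, hR, by positivity, fun z hz => (hsub hz).2,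
    hK.mono fun z hz => (hsub hz).1.1.1, hL.mono fun z hz => (hsub hz).1.1.2, fun z hz => ?_⟩
  have a1 : ‖W z‖ < ‖W z₀‖ + 1 := (hsub hz).1.2
  have a2 : dist (fderiv ℝ W z) (fderiv ℝ W z₀) ≤ L * R :=
    (hL.dist_le_mul z (hsub hz).1.1.2 z₀ (mem_of_mem_nhds ht)).trans (by gcongr; exact hz)
  have a2' : ‖fderiv ℝ W z - fderiv ℝ W z₀‖ ≤ L * R :=
    le_of_eq_of_le (dist_eq_norm (fderiv ℝ W z) (fderiv ℝ W z₀)).symm a2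
  have a3 : ‖fderiv ℝ W z‖ ≤ ‖fderiv ℝ W z - fderiv ℝ W z₀‖ + ‖fderiv ℝ W z₀‖ :=
    norm_le_norm_sub_add (fderiv ℝ W z) (fderiv ℝ W z₀)
  have : 0 ≤ L * R := by positivity
  have := norm_nonneg (W z₀)
  have := norm_nonneg (fderiv ℝ W z₀)
  constructor <;> linarith

theorem radial_exists {E : Type*} [NormedAddCommGroup E] [NormedSpace ℝ E]
    (W : E × ℝ → E →L[ℝ] ℝ) (p₀ : E) (c R M : ℝ) (K : NNReal) (hR : 0 < R) (hM : 0 < M)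
    (hK : LipschitzOnWith K W (closedBall (p₀, c) R))
    (hMb : ∀ z ∈ closedBall (p₀, c) R, ‖W z‖ ≤ M) (v : E) (hv : ‖v‖ ≤ R) (hv' : M * ‖v‖ ≤ R / 2) :
    ∃ α : ℝ → ℝ, α 0 = c ∧ ∀ r ∈ Icc (0:ℝ) 1, α r ∈ closedBall c (R / 2) ∧
      HasDerivWithinAt α (W (p₀ + r • v, α r) v) (Icc 0 1) r := by
  have hmem : ∀ r ∈ Icc (0:ℝ) 1, ∀ y ∈ closedBall c (R/2),
      (p₀ + r • v, y) ∈ closedBall (p₀, c) R := by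
    intro r hr y hy
    rw [← closedBall_prod_same]
    refine ⟨?_, closedBall_subset_closedBall (by linarith) hy⟩
    rw [mem_closedBall_iff_norm, add_sub_cancel_left, norm_smul, Real.norm_of_nonneg hr.1]
    nlinarith [hr.1, hr.2, norm_nonneg v]
  have hpl : IsPicardLindelof (fun r y => W (p₀ + r • v, y) v) (tmin := 0) (tmax := 1)
      ⟨0, by simp⟩ c (.mk (R/2) (by positivity)) 0 (.mk (M * ‖v‖) (by positivity)) (K * ‖v‖₊) := by
    refine ⟨?_, ?_, ?_, ?_⟩
    · intro r hr
      apply LipschitzOnWith.of_dist_le_mul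
      intro y hy y' hy'
      have := hK.dist_le_mul _ (hmem r hr y hy) _ (hmem r hr y' hy')
      rw [dist_eq_norm] at this ⊢
      rw [← sub_apply]
      refine (ContinuousLinearMap.le_opNorm _ _).trans ?_
      have e : dist (p₀ + r • v, y) (p₀ + r • v, y') = dist y y' := by
        simp [Prod.dist_eq]
      rw [e] at this
      push_cast
      rw [mul_right_comm]
      gcongr
    · intro y hy
      have : ContinuousOn (fun r : ℝ => W (p₀ + r • v, y)) (Icc 0 1) :=
        hK.continuousOn.comp (by fun_prop) (fun r hr => hmem r hr y hy)
      exact this.clm_apply continuousOn_const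
    · intro r hr y hy
      refine (ContinuousLinearMap.le_opNorm _ _).trans ?_
      have := hMb _ (hmem r hr y hy)
      simp only [NNReal.coe_mk]
      gcongr
    · simp
      exact hv'
  obtain ⟨α, hα⟩ := ODE.FunSpace.exists_isFixedPt_next hpl (x := c) (by simp)
  have hα' := (ODE.FunSpace.isFixedPt_next_iff hpl _).1 hα
  refine ⟨α.compProj, ?_, fun r hr => ⟨?_, ?_⟩⟩
  · have := hα' ⟨0, by simp⟩
    rw [ODE.FunSpace.compProj_of_mem (by simp : (0:ℝ) ∈ Icc (0:ℝ) 1), this]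
    simp
  · exact α.compProj_mem_closedBall hpl.mul_max_le
  · have key : ∀ r ∈ Icc (0:ℝ) 1, α.compProj r =
        ODE.picard (fun r y => W (p₀ + r • v, y) v) 0 c α.compProj r := by
      intro r hr
      rw [ODE.FunSpace.compProj_of_mem hr, hα']
    refine (ODE.hasDerivWithinAt_picard_Icc (f := fun r y => W (p₀ + r • v, y) v)
      (u := closedBall c (R/2)) (by simp) ?_ α.continuous_compProj.continuousOn ?_ c hr).congr_of_mem key hr
    · exact continuousOn_prod_of_continuousOn_lipschitzOnWith' _ _ hpl.lipschitzOnWith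
        hpl.continuousOn
    · exact fun _ _ => α.compProj_mem_closedBall hpl.mul_max_le

theorem frob_est {E : Type*} [NormedAddCommGroup E] [NormedSpace ℝ E]
    (W : E × ℝ → E →L[ℝ] ℝ) (p₀ : E) (c R M : ℝ) (K L : NNReal) (hR : 0 < R) (hM : 0 < M)
    (hd : ∀ z ∈ closedBall (p₀, c) R, DifferentiableAt ℝ W z)
    (hcomp : ∀ z ∈ closedBall (p₀, c) R, ∀ v k : E,
      fderiv ℝ W z (v, W z v) k = fderiv ℝ W z (k, W z k) v)
    (hK : LipschitzOnWith K W (closedBall (p₀, c) R))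
    (hL : LipschitzOnWith L (fderiv ℝ W) (closedBall (p₀, c) R))
    (hMb : ∀ z ∈ closedBall (p₀, c) R, ‖W z‖ ≤ M ∧ ‖fderiv ℝ W z‖ ≤ M)
    (v k : E) (hv : ‖v‖ ≤ R) (hvk : ‖v + k‖ ≤ R) (hk : M * ‖k‖ ≤ R / 2) (α β : ℝ → ℝ)
    (hα0 : α 0 = c) (hα : ∀ r ∈ Icc (0:ℝ) 1, α r ∈ closedBall c (R / 2) ∧
      HasDerivWithinAt α (W (p₀ + r • v, α r) v) (Icc 0 1) r)
    (hβ0 : β 0 = c) (hβ : ∀ r ∈ Icc (0:ℝ) 1, β r ∈ closedBall c (R / 2) ∧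
      HasDerivWithinAt β (W (p₀ + r • (v + k), β r) (v + k)) (Icc 0 1) r) :
    |β 1 - α 1 - W (p₀ + v, α 1) k| ≤
      gronwallBound 0 (K * R + 1) 1 1 * (L * (1 + M) ^ 2 * R + M * (1 + M)) * ‖k‖ ^ 2 := by
  have hmem : ∀ r ∈ Icc (0:ℝ) 1, ∀ w : E, ‖w‖ ≤ R → ∀ y ∈ closedBall c R,
      (p₀ + r • w, y) ∈ closedBall (p₀, c) R := by
    intro r hr w hw y hy
    rw [← closedBall_prod_same]
    refine ⟨?_, hy⟩
    rw [mem_closedBall_iff_norm, add_sub_cancel_left, norm_smul, Real.norm_of_nonneg hr.1]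
    nlinarith [hr.1, hr.2, norm_nonneg w]
  have hhalf : closedBall c (R/2) ⊆ closedBall c R := closedBall_subset_closedBall (by linarith)
  set z : ℝ → E × ℝ := fun r => (p₀ + r • v, α r) with hz
  have hzm : ∀ r ∈ Icc (0:ℝ) 1, z r ∈ closedBall (p₀, c) R := fun r hr =>
    hmem r hr v hv _ (hhalf (hα r hr).1)
  set g : ℝ → ℝ := fun r => α r + r * W (z r) k with hg
  have hgm : ∀ r ∈ Icc (0:ℝ) 1, g r ∈ closedBall c R := by
    intro r hr
    have h1 := (hα r hr).1
    rw [mem_closedBall_iff_norm] at h1 ⊢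
    have h2 : ‖W (z r) k‖ ≤ M * ‖k‖ := (ContinuousLinearMap.le_opNorm _ _).trans
      (by gcongr; exact (hMb _ (hzm r hr)).1)
    have h3 : ‖r * W (z r) k‖ ≤ M * ‖k‖ := by
      rw [norm_mul, Real.norm_of_nonneg hr.1]
      nlinarith [hr.1, hr.2, norm_nonneg (W (z r) k)]
    calc ‖g r - c‖ = ‖(α r - c) + r * W (z r) k‖ := by simp only [hg]; congr 1; ring
      _ ≤ _ := norm_add_le _ _
      _ ≤ R := by linarith
  have hgd : ∀ r ∈ Icc (0:ℝ) 1, HasDerivWithinAt g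
      (W (z r) v + (W (z r) k + r * fderiv ℝ W (z r) (v, W (z r) v) k)) (Icc 0 1) r := by
    intro r hr
    have hzd : HasDerivWithinAt z (v, W (z r) v) (Icc 0 1) r := by
      refine HasDerivWithinAt.prodMk ?_ (hα r hr).2
      have : HasDerivWithinAt (fun r : ℝ => p₀ + r • v) ((1:ℝ) • v) (Icc 0 1) r :=
        ((hasDerivWithinAt_id r _).smul_const v).const_add p₀
      simpa using this
    have hWd := (hd _ (hzm r hr)).hasFDerivAt.comp_hasDerivWithinAt r hzd
    have hWk : HasDerivWithinAt (fun r => W (z r) k) (fderiv ℝ W (z r) (v, W (z r) v) k)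
        (Icc 0 1) r := by
      simpa using hWd.clm_apply (hasDerivWithinAt_const r _ k)
    have := (hα r hr).2.add ((hasDerivWithinAt_id r (Icc (0:ℝ) 1)).mul hWk)
    simp only [one_mul, id_eq] at this
    exact this
  have hIci : ∀ (f : ℝ → ℝ) (f' r : ℝ), r ∈ Ico (0:ℝ) 1 → HasDerivWithinAt f f' (Icc 0 1) r →
      HasDerivWithinAt f f' (Ici r) r := fun f f' r hr h =>
    h.mono_of_mem_nhdsWithin (Icc_mem_nhdsGE_of_mem hr)
  have herr : ∀ r ∈ Ico (0:ℝ) 1,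
      dist (W (z r) v + (W (z r) k + r * fderiv ℝ W (z r) (v, W (z r) v) k))
        (W (p₀ + r • (v + k), g r) (v + k)) ≤
      (L * (1 + M) ^ 2 * R + M * (1 + M)) * ‖k‖ ^ 2 := by
    intro r hr'
    have hr : r ∈ Icc (0:ℝ) 1 := Ico_subset_Icc_self hr'
    set δ : E × ℝ := r • (k, W (z r) k) with hδ
    have hzδ : (p₀ + r • (v + k), g r) = z r + δ := by
      simp [hz, hδ, hg, add_assoc]
    have hδn : ‖δ‖ ≤ (1 + M) * ‖k‖ := by
      rw [hδ, norm_smul, Real.norm_of_nonneg hr.1]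
      have h2 : ‖W (z r) k‖ ≤ M * ‖k‖ := (ContinuousLinearMap.le_opNorm _ _).trans
        (by gcongr; exact (hMb _ (hzm r hr)).1)
      have h3 : ‖(k, W (z r) k)‖ ≤ (1 + M) * ‖k‖ := by
        rw [Prod.norm_def]
        refine max_le ?_ ?_ <;> nlinarith [norm_nonneg k]
      nlinarith [hr.1, hr.2, norm_nonneg (k, W (z r) k)]
    have hzδm : z r + δ ∈ closedBall (p₀, c) R := by
      rw [← hzδ]; exact hmem r hr _ hvk _ (hgm r hr)
    have htay : ‖W (z r + δ) - W (z r) - fderiv ℝ W (z r) δ‖ ≤ (L * ‖δ‖) * ‖δ‖ := by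
      have := Convex.norm_image_sub_le_of_norm_fderiv_le' (𝕜 := ℝ) (f := W)
        (s := closedBall (p₀, c) R ∩ closedBall (z r) ‖δ‖) (φ := fderiv ℝ W (z r))
        (C := L * ‖δ‖) (x := z r) (y := z r + δ)
        (fun x hx => hd x hx.1) (fun x hx => ?_)
        ((convex_closedBall _ _).inter (convex_closedBall _ _))
        ⟨hzm r hr, by simp⟩ ⟨hzδm, by simp⟩
      · simpa using this
      · rw [← dist_eq_norm]
        refine (hL.dist_le_mul _ hx.1 _ (hzm r hr)).trans ?_
        gcongr
        exact hx.2
    have hW'δ : ‖fderiv ℝ W (z r) δ‖ ≤ M * ‖δ‖ := (ContinuousLinearMap.le_opNorm _ _).trans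
        (by gcongr; exact (hMb _ (hzm r hr)).2)
    have e : W (z r) v + (W (z r) k + r * fderiv ℝ W (z r) (v, W (z r) v) k)
        - W (z r + δ) (v + k) =
        -((W (z r + δ) - W (z r) - fderiv ℝ W (z r) δ) (v + k)) - fderiv ℝ W (z r) δ k := by
      rw [hcomp _ (hzm r hr) v k]
      have : fderiv ℝ W (z r) δ = r • fderiv ℝ W (z r) (k, W (z r) k) := by
        rw [hδ, map_smul]
      simp only [sub_apply, map_add, this, smul_apply, smul_eq_mul]
      ring
    rw [hzδ, dist_eq_norm, e]
    calc _ ≤ ‖-((W (z r + δ) - W (z r) - fderiv ℝ W (z r) δ) (v + k))‖ +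
          ‖fderiv ℝ W (z r) δ k‖ := norm_sub_le _ _
      _ ≤ ‖W (z r + δ) - W (z r) - fderiv ℝ W (z r) δ‖ * ‖v + k‖ +
          ‖fderiv ℝ W (z r) δ‖ * ‖k‖ := by
          rw [norm_neg]
          exact add_le_add (ContinuousLinearMap.le_opNorm _ _) (ContinuousLinearMap.le_opNorm _ _)
      _ ≤ ((L * ((1 + M) * ‖k‖)) * ((1 + M) * ‖k‖)) * R + (M * ((1 + M) * ‖k‖)) * ‖k‖ := by
          gcongr
          · exact htay.trans (by gcongr)
          · exact hW'δ.trans (by gcongr)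
      _ = _ := by ring
  have hgr := dist_le_of_approx_trajectories_ODE_of_mem
    (v := fun r y => W (p₀ + r • (v + k), y) (v + k)) (s := fun _ => closedBall c R)
    (K := K * (.mk R hR.le) + 1) (a := 0) (b := 1) (f := β) (g := g)
    (f' := fun r => W (p₀ + r • (v + k), β r) (v + k)) (εf := 0) (δ := 0)
    (g' := fun r => W (z r) v + (W (z r) k + r * fderiv ℝ W (z r) (v, W (z r) v) k))
    (εg := (L * (1 + M) ^ 2 * R + M * (1 + M)) * ‖k‖ ^ 2)
    (fun r hr => ?_) (fun r hr => (hβ r hr).2.continuousWithinAt)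
    (fun r hr => hIci _ _ _ hr (hβ r (Ico_subset_Icc_self hr)).2)
    (fun r hr => by simp) (fun r hr => hhalf (hβ r (Ico_subset_Icc_self hr)).1)
    (fun r hr => (hgd r hr).continuousWithinAt)
    (fun r hr => hIci _ _ _ hr (hgd r (Ico_subset_Icc_self hr)))
    herr (fun r hr => hgm r (Ico_subset_Icc_self hr))
    (by simp [hg, hα0, hβ0]) 1 (by simp)
  · have hpos : (K * R + 1 : ℝ) ≠ 0 := by positivity
    rw [Real.dist_eq] at hgr
    have e1 : β 1 - α 1 - W (p₀ + v, α 1) k = β 1 - g 1 := by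
      simp [hg, hz]; ring
    rw [e1]
    refine hgr.trans (le_of_eq ?_)
    push_cast
    rw [gronwallBound_of_K_ne_0 hpos, gronwallBound_of_K_ne_0 hpos]
    simp
    ring
  · have hr' := Ico_subset_Icc_self hr
    apply LipschitzOnWith.of_dist_le_mul
    intro y hy y' hy'
    have := hK.dist_le_mul _ (hmem r hr' _ hvk y hy) _ (hmem r hr' _ hvk y' hy')
    rw [dist_eq_norm] at this ⊢
    rw [← sub_apply]
    refine (ContinuousLinearMap.le_opNorm _ _).trans ?_
    have e : dist (p₀ + r • (v + k), y) (p₀ + r • (v + k), y') = dist y y' := by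
      simp [Prod.dist_eq]
    rw [e] at this
    push_cast
    have h0 : 0 ≤ dist y y' := dist_nonneg
    calc _ ≤ (K * dist y y') * R := by gcongr
      _ ≤ _ := by nlinarith

theorem frob_exists {E : Type*} [NormedAddCommGroup E] [NormedSpace ℝ E]
    (W : E × ℝ → E →L[ℝ] ℝ) (Ω : Set (E × ℝ)) (hΩ : IsOpen Ω) (hW : ContDiffOn ℝ 2 W Ω)
    (hcomp : ∀ z ∈ Ω, ∀ v k : E,
      fderiv ℝ W z (v, W z v) k = fderiv ℝ W z (k, W z k) v)
    (p₀ : E) (c : ℝ) (hz₀ : (p₀, c) ∈ Ω) :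
    ∃ V : Set E, IsOpen V ∧ p₀ ∈ V ∧ ∃ φ : E → ℝ, φ p₀ = c ∧
      ∀ p ∈ V, (p, φ p) ∈ Ω ∧ HasFDerivAt φ (W (p, φ p)) p := by
  obtain ⟨R, K, L, M, hR, hM, hsub, hK, hL, hMb⟩ := frob_consts W Ω hΩ hW _ hz₀
  have hd : ∀ z ∈ closedBall (p₀, c) R, DifferentiableAt ℝ W z := fun z hz =>
    (hW.contDiffAt (hΩ.mem_nhds (hsub hz))).differentiableAt (by norm_num)
  set ρ := min R (R / 2 / M) with hρ
  have hρ0 : 0 < ρ := by positivity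
  have hρ1 : ρ ≤ R := min_le_left _ _
  have hρ2 : M * ρ ≤ R / 2 := by
    have : ρ ≤ R / 2 / M := min_le_right _ _
    rw [le_div_iff₀ hM] at this
    linarith
  have hex : ∀ v : E, ∃ α : ℝ → ℝ, ‖v‖ < ρ → α 0 = c ∧ ∀ r ∈ Icc (0:ℝ) 1,
      α r ∈ closedBall c (R / 2) ∧ HasDerivWithinAt α (W (p₀ + r • v, α r) v) (Icc 0 1) r := by
    intro v
    by_cases hv : ‖v‖ < ρ
    · obtain ⟨α, h⟩ := radial_exists W p₀ c R M K hR hM hK (fun z hz => (hMb z hz).1) v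
        (hv.le.trans hρ1) ((mul_le_mul_of_nonneg_left hv.le hM.le).trans hρ2)
      exact ⟨α, fun _ => h⟩
    · exact ⟨0, fun h => absurd h hv⟩
  choose α hα using hex
  refine ⟨ball p₀ ρ, isOpen_ball, mem_ball_self hρ0, fun p => α (p - p₀) 1, ?_, ?_⟩
  · have h := hα 0 (by simpa using hρ0)
    have hdz : DifferentiableOn ℝ (α 0) (Icc 0 1) := fun r hr => (h.2 r hr).2.differentiableWithinAt
    have := constant_of_derivWithin_zero hdz (fun r hr => by
      have h1 := (h.2 r (Ico_subset_Icc_self hr)).2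
      rw [h1.derivWithin (uniqueDiffOn_Icc zero_lt_one r (Ico_subset_Icc_self hr))]
      simp) 1 (by simp)
    simp [this, h.1]
  · intro p hp
    have hv : ‖p - p₀‖ < ρ := by simpa [dist_eq_norm] using hp
    set v := p - p₀ with hvdef
    have hpv : p = p₀ + v := by simp [hvdef]
    obtain ⟨h0, h1⟩ := hα v hv
    refine ⟨hsub ?_, ?_⟩
    · rw [← closedBall_prod_same]
      refine ⟨?_, closedBall_subset_closedBall (by linarith) (h1 1 (by simp)).1⟩
      rw [mem_closedBall_iff_norm]; exact hv.le.trans hρ1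
    · rw [hasFDerivAt_iff_isLittleO_nhds_zero]
      refine Asymptotics.IsBigO.trans_isLittleO (g := fun k : E => ‖k‖ ^ 2) ?_
        (Asymptotics.isLittleO_norm_pow_id one_lt_two)
      refine Asymptotics.IsBigO.of_bound
        (gronwallBound 0 (K * R + 1) 1 1 * (L * (1 + M) ^ 2 * R + M * (1 + M))) ?_
      have ev1 : ∀ᶠ k : E in 𝓝 0, ‖v + k‖ < ρ :=
        ContinuousAt.eventually_lt (by fun_prop) continuousAt_const (by simpa using hv)
      have ev2 : ∀ᶠ k : E in 𝓝 0, M * ‖k‖ < R / 2 :=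
        ContinuousAt.eventually_lt (by fun_prop) continuousAt_const (by simpa using hR)
      filter_upwards [ev1, ev2] with k hk1 hk2
      have hk := hα (v + k) hk1
      have := frob_est W p₀ c R M K L hR hM hd (fun z hz => hcomp z (hsub hz)) hK hL hMb v k
        (hv.le.trans hρ1) (hk1.le.trans hρ1) hk2.le (α v) (α (v + k)) h0 h1 hk.1 hk.2
      have e : p + k - p₀ = v + k := by rw [hpv]; abel
      rw [e, Real.norm_eq_abs, norm_pow, norm_norm]
      have e2 : (W (p, α v 1)) k = (W (p₀ + v, α v 1)) k := by rw [← hpv]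
      rw [e2]
      exact this

theorem frob_smooth {E : Type*} [NormedAddCommGroup E] [NormedSpace ℝ E]
    (W : E × ℝ → E →L[ℝ] ℝ) (Ω : Set (E × ℝ)) (hW : ContDiffOn ℝ (⊤ : ℕ∞) W Ω)
    (V : Set E) (hV : IsOpen V) (φ : E → ℝ)
    (hφ : ∀ p ∈ V, (p, φ p) ∈ Ω ∧ HasFDerivAt φ (W (p, φ p)) p) :
    ContDiffOn ℝ (⊤ : ℕ∞) φ V := by
  rw [contDiffOn_infty]
  intro n
  induction n with
  | zero =>
    exact contDiffOn_zero.2 fun p hp => (hφ p hp).2.continuousAt.continuousWithinAt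
  | succ n ih =>
    push_cast
    rw [contDiffOn_succ_iff_fderiv_of_isOpen hV]
    refine ⟨fun p hp => (hφ p hp).2.differentiableAt.differentiableWithinAt, by simp, ?_⟩
    refine ContDiffOn.congr (f := fun p => W (p, φ p)) ?_ (fun p hp => (hφ p hp).2.fderiv)
    exact (contDiffOn_infty.1 hW n).comp (contDiffOn_id.prodMk ih) (fun p hp => (hφ p hp).1)

theorem frob_unique_s3 {E : Type*} [NormedAddCommGroup E] [NormedSpace ℝ E]
    (W : E × ℝ → E →L[ℝ] ℝ) (Ω : Set (E × ℝ)) (hΩ : IsOpen Ω) (hW : ContDiffOn ℝ 2 W Ω)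
    (V : Set E) (hV : IsOpen V) (hVc : IsPreconnected V) (p₀ : E) (hp₀ : p₀ ∈ V) (φ ψ : E → ℝ)
    (hφ : ∀ p ∈ V, (p, φ p) ∈ Ω ∧ HasFDerivAt φ (W (p, φ p)) p)
    (hψ : ∀ p ∈ V, (p, ψ p) ∈ Ω ∧ HasFDerivAt ψ (W (p, ψ p)) p)
    (h0 : φ p₀ = ψ p₀) : EqOn φ ψ V := by
  have hcφ : ContinuousOn φ V := fun p hp => (hφ p hp).2.continuousAt.continuousWithinAt
  have hcψ : ContinuousOn ψ V := fun p hp => (hψ p hp).2.continuousAt.continuousWithinAt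
  have hloc : ∀ q ∈ V, φ q = ψ q → ∀ᶠ p in 𝓝 q, φ p = ψ p := by
    intro q hq hqe
    obtain ⟨R, K, L, M, hR, hM, hsub, hK, hL, hMb⟩ := frob_consts W Ω hΩ hW _ (hφ q hq).1
    have e1 : ∀ᶠ p in 𝓝 q, φ p ∈ closedBall (φ q) R :=
      (hφ q hq).2.continuousAt.eventually_mem (closedBall_mem_nhds _ hR)
    have e2 : ∀ᶠ p in 𝓝 q, ψ p ∈ closedBall (φ q) R := by
      rw [hqe]
      exact (hψ q hq).2.continuousAt.eventually_mem (closedBall_mem_nhds _ hR)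
    have e3 : ∀ᶠ p in 𝓝 q, p ∈ closedBall q R := closedBall_mem_nhds _ hR
    have e4 : ∀ᶠ p in 𝓝 q, p ∈ V := hV.mem_nhds hq
    obtain ⟨ρ, hρ, hall⟩ := Metric.eventually_nhds_iff_ball.1 (e1.and (e2.and (e3.and e4)))
    filter_upwards [ball_mem_nhds q hρ] with p hp
    set v := p - q with hv
    have hseg : ∀ r ∈ Icc (0:ℝ) 1, q + r • v ∈ ball q ρ := by
      intro r hr
      exact (convex_ball q ρ).add_smul_sub_mem (mem_ball_self hρ) hp hr
    have hder : ∀ χ : E → ℝ, (∀ p ∈ V, (p, χ p) ∈ Ω ∧ HasFDerivAt χ (W (p, χ p)) p) →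
        ∀ r ∈ Icc (0:ℝ) 1, HasDerivAt (fun r : ℝ => χ (q + r • v))
          (W (q + r • v, χ (q + r • v)) v) r := by
      intro χ hχ r hr
      have h1 : HasDerivAt (fun r : ℝ => q + r • v) ((1:ℝ) • v) r :=
        ((hasDerivAt_id r).smul_const v).const_add q
      rw [one_smul] at h1
      exact (hχ _ (hall _ (hseg r hr)).2.2.2).2.comp_hasDerivAt r h1
    have := ODE_solution_unique_of_mem_Icc_right
      (v := fun r y => W (q + r • v, y) v) (s := fun _ => closedBall (φ q) R)
      (K := K * ‖v‖₊) (a := 0) (b := 1) (f := fun r => φ (q + r • v))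
      (g := fun r => ψ (q + r • v)) (fun r hr => ?_)
      (fun r hr => (hder φ hφ r hr).continuousAt.continuousWithinAt)
      (fun r hr => (hder φ hφ r (Ico_subset_Icc_self hr)).hasDerivWithinAt)
      (fun r hr => (hall _ (hseg r (Ico_subset_Icc_self hr))).1)
      (fun r hr => (hder ψ hψ r hr).continuousAt.continuousWithinAt)
      (fun r hr => (hder ψ hψ r (Ico_subset_Icc_self hr)).hasDerivWithinAt)
      (fun r hr => (hall _ (hseg r (Ico_subset_Icc_self hr))).2.1)
      (by simpa using hqe)
    · have h1 := this (by simp : (1:ℝ) ∈ Icc (0:ℝ) 1)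
      simpa [hv] using h1
    · have hr' := Ico_subset_Icc_self hr
      have hm : ∀ y ∈ closedBall (φ q) R, (q + r • v, y) ∈ closedBall (q, φ q) R := by
        intro y hy
        rw [← closedBall_prod_same]
        exact ⟨(hall _ (hseg r hr')).2.2.1, hy⟩
      apply LipschitzOnWith.of_dist_le_mul
      intro y hy y' hy'
      have := hK.dist_le_mul _ (hm y hy) _ (hm y' hy')
      rw [dist_eq_norm] at this ⊢
      rw [← sub_apply]
      refine (ContinuousLinearMap.le_opNorm _ _).trans ?_
      have e : dist (q + r • v, y) (q + r • v, y') = dist y y' := by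
        simp [Prod.dist_eq]
      rw [e] at this
      push_cast
      rw [mul_right_comm]
      gcongr
  have hsubset : V ⊆ {p | ∀ᶠ p' in 𝓝 p, φ p' = ψ p'} := by
    refine hVc.subset_of_closure_inter_subset isOpen_setOfPred_eventually_nhds
      ⟨p₀, hp₀, hloc p₀ hp₀ h0⟩ ?_
    rintro q ⟨hqc, hqV⟩
    refine hloc q hqV ?_
    have hfr : ∃ᶠ p in 𝓝 q, φ p = ψ p := by
      rw [mem_closure_iff_frequently] at hqc
      exact hqc.mono fun p hp => Eventually.self_of_nhds (p := fun p' => φ p' = ψ p') hp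
    by_contra hne
    have : ∀ᶠ p in 𝓝 q, φ p ≠ ψ p :=
      (hφ q hqV).2.continuousAt.ne_iff_eventually_ne (hψ q hqV).2.continuousAt |>.1 hne
    exact (hfr.and_eventually this).exists.elim fun p hp => hp.2 hp.1
  exact fun p hp => Eventually.self_of_nhds (p := fun p' => φ p' = ψ p') (hsubset hp)

/-- Right-hand side of the `x`-equation. -/
noncomputable def chA (m : ℝ) (u : ℝ × ℝ → ℝ) (z : (ℝ × ℝ) × ℝ) : ℝ :=
  (chH m u z.1 - 1) * Real.sin z.2 + chH m u z.1

/-- Right-hand side of the `t`-equation. -/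
noncomputable def chB (m : ℝ) (u : ℝ × ℝ → ℝ) (z : (ℝ × ℝ) × ℝ) : ℝ :=
  pdx u z.1 * Real.cos z.2 - (u z.1 * chH m u z.1 + m / 2 - 1) * Real.sin z.2
      - u z.1 * (chH m u z.1 + 1) - m / 2

/-- The connection form. -/
noncomputable def chW (m : ℝ) (u : ℝ × ℝ → ℝ) (z : (ℝ × ℝ) × ℝ) : ℝ × ℝ →L[ℝ] ℝ :=
  chA m u z • ContinuousLinearMap.fst ℝ ℝ ℝ + chB m u z • ContinuousLinearMap.snd ℝ ℝ ℝ

theorem pdx_smooth {U : Set (ℝ × ℝ)} (hU : IsOpen U) {u : ℝ × ℝ → ℝ}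
    (hu : ContDiffOn ℝ (⊤ : ℕ∞) u U) : ContDiffOn ℝ (⊤ : ℕ∞) (pdx u) U := by
  have : ContDiffOn ℝ (⊤ : ℕ∞) (fderiv ℝ u) U := hu.fderiv_of_isOpen hU (by simp)
  exact this.clm_apply contDiffOn_const

theorem chH_smooth (m : ℝ) {U : Set (ℝ × ℝ)} (hU : IsOpen U) {u : ℝ × ℝ → ℝ}
    (hu : ContDiffOn ℝ (⊤ : ℕ∞) u U) : ContDiffOn ℝ (⊤ : ℕ∞) (chH m u) U :=
  (hu.sub (pdx_smooth hU (pdx_smooth hU hu))).add contDiffOn_const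

theorem chW_smooth (m : ℝ) {U : Set (ℝ × ℝ)} (hU : IsOpen U) {u : ℝ × ℝ → ℝ}
    (hu : ContDiffOn ℝ (⊤ : ℕ∞) u U) : ContDiffOn ℝ (⊤ : ℕ∞) (chW m u) (U ×ˢ univ) := by
  have hm : MapsTo (Prod.fst : (ℝ × ℝ) × ℝ → ℝ × ℝ) (U ×ˢ univ) U := fun z hz => hz.1
  have hf : ContDiffOn ℝ (⊤ : ℕ∞) (Prod.fst : (ℝ × ℝ) × ℝ → ℝ × ℝ) (U ×ˢ univ) :=
    contDiff_fst.contDiffOn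
  have h1 : ContDiffOn ℝ (⊤ : ℕ∞) (fun z : (ℝ × ℝ) × ℝ => u z.1) (U ×ˢ univ) := hu.comp hf hm
  have h2 : ContDiffOn ℝ (⊤ : ℕ∞) (fun z : (ℝ × ℝ) × ℝ => pdx u z.1) (U ×ˢ univ) :=
    (pdx_smooth hU hu).comp hf hm
  have h3 : ContDiffOn ℝ (⊤ : ℕ∞) (fun z : (ℝ × ℝ) × ℝ => chH m u z.1) (U ×ˢ univ) :=
    (chH_smooth m hU hu).comp hf hm
  have hs : ContDiffOn ℝ (⊤ : ℕ∞) (fun z : (ℝ × ℝ) × ℝ => Real.sin z.2) (U ×ˢ univ) :=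
    (Real.contDiff_sin.comp contDiff_snd).contDiffOn
  have hc : ContDiffOn ℝ (⊤ : ℕ∞) (fun z : (ℝ × ℝ) × ℝ => Real.cos z.2) (U ×ˢ univ) :=
    (Real.contDiff_cos.comp contDiff_snd).contDiffOn
  have hA : ContDiffOn ℝ (⊤ : ℕ∞) (chA m u) (U ×ˢ univ) :=
    ((h3.sub contDiffOn_const).mul hs).add h3
  have hB : ContDiffOn ℝ (⊤ : ℕ∞) (chB m u) (U ×ˢ univ) :=
    (((h2.mul hc).sub ((((h1.mul h3).add contDiffOn_const).sub contDiffOn_const).mul hs)).sub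
      (h1.mul (h3.add contDiffOn_const))).sub contDiffOn_const
  exact (hA.smul contDiffOn_const).add (hB.smul contDiffOn_const)

theorem chW_compat (m : ℝ) {U : Set (ℝ × ℝ)} (hU : IsOpen U) {u : ℝ × ℝ → ℝ}
    (hu : ContDiffOn ℝ (⊤ : ℕ∞) u U) (hCH : ∀ p ∈ U, CamassaHolm m u p) :
    ∀ z ∈ U ×ˢ (univ : Set ℝ), ∀ v k : ℝ × ℝ,
      fderiv ℝ (chW m u) z (v, chW m u z v) k = fderiv ℝ (chW m u) z (k, chW m u z k) v := by
  rintro ⟨p, y⟩ ⟨hp, -⟩ v k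
  simp only at hp
  have dif : ∀ f : ℝ × ℝ → ℝ, ContDiffOn ℝ (⊤ : ℕ∞) f U → HasFDerivAt f (fderiv ℝ f p) p :=
    fun f hf => ((hf.contDiffAt (hU.mem_nhds hp)).differentiableAt (by simp)).hasFDerivAt
  have hux := pdx_smooth hU hu
  have huxx := pdx_smooth hU hux
  have d1 := dif u hu
  have d2 := dif _ hux
  have d4 := dif _ huxx
  have d3 : HasFDerivAt (chH m u) (fderiv ℝ u p - fderiv ℝ (pdx (pdx u)) p) p :=
    (d1.sub d4).add_const _
  have hf : HasFDerivAt (Prod.fst : (ℝ × ℝ) × ℝ → ℝ × ℝ) (ContinuousLinearMap.fst ℝ (ℝ × ℝ) ℝ)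
    (p, y) := hasFDerivAt_fst
  have hsn : HasFDerivAt (Prod.snd : (ℝ × ℝ) × ℝ → ℝ) (ContinuousLinearMap.snd ℝ (ℝ × ℝ) ℝ)
    (p, y) := hasFDerivAt_snd
  have c1 := HasFDerivAt.comp (p, y) (g := u) d1 hf
  have c2 := HasFDerivAt.comp (p, y) (g := pdx u) d2 hf
  have c3 := HasFDerivAt.comp (p, y) (g := chH m u) d3 hf
  have hA := ((c3.sub_const 1).mul hsn.sin).add c3
  have hB := (((c2.mul hsn.cos).sub ((((c1.mul c3).add_const (m/2)).sub_const 1).mul hsn.sin)).sub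
      (c1.mul (c3.add_const 1))).sub_const (m/2)
  have hWd := (hA.smul_const (ContinuousLinearMap.fst ℝ ℝ ℝ)).add
    (hB.smul_const (ContinuousLinearMap.snd ℝ ℝ ℝ))
  have hW : HasFDerivAt (chW m u) _ (p, y) := hWd
  rw [hW.fderiv]
  have ex : ∀ (f : ℝ × ℝ → ℝ) (w : ℝ × ℝ), fderiv ℝ f p w = w.1 * pdx f p + w.2 * pdt f p := by
    intro f w
    have : w = w.1 • ((1:ℝ), (0:ℝ)) + w.2 • ((0:ℝ), (1:ℝ)) := by ext <;> simp
    conv_lhs => rw [this]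
    rw [map_add, map_smul, map_smul]; rfl
  have hch := hCH p hp
  unfold CamassaHolm at hch
  have hsc := Real.sin_sq_add_cos_sq y
  simp only [chW, chA, chB, add_apply, sub_apply, smul_apply, smul_eq_mul, Function.comp_apply, Pi.mul_apply,
    ContinuousLinearMap.comp_apply, ContinuousLinearMap.smulRight_apply,
    ContinuousLinearMap.coe_fst', ContinuousLinearMap.coe_snd', ex, chH]
  generalize pdx (pdx (pdx u)) p = uxxx at *
  generalize pdt (pdx (pdx u)) p = uxxt at *
  generalize pdx (pdx u) p = uxx at *
  generalize pdt (pdx u) p = uxt at *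
  generalize pdx u p = ux at *
  generalize pdt u p = ut at *
  generalize u p = q at *
  generalize Real.sin y = s at *
  generalize Real.cos y = c at *
  obtain ⟨v1, v2⟩ := v
  obtain ⟨k1, k2⟩ := k
  simp only
  linear_combination (v2 * k1 - v1 * k2) * ((1 + s) * hch + (q - uxx + m/2 - 1) * ux * hsc)

theorem sys_iff (m : ℝ) {U V : Set (ℝ × ℝ)} (hVU : V ⊆ U) (hV : IsOpen V) {u φ : ℝ × ℝ → ℝ}
    (hφ : ContDiffOn ℝ (⊤ : ℕ∞) φ V) (h : CHAngleSystem m u φ V) :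
    ∀ p ∈ V, (p, φ p) ∈ U ×ˢ (univ : Set ℝ) ∧ HasFDerivAt φ (chW m u (p, φ p)) p := by
  intro p hp
  refine ⟨⟨hVU hp, trivial⟩, ?_⟩
  have hd := ((hφ.contDiffAt (hV.mem_nhds hp)).differentiableAt (by simp)).hasFDerivAt
  obtain ⟨h1, h2⟩ := h p hp
  unfold pdx at h1
  unfold pdt at h2
  have heq : chW m u (p, φ p) = fderiv ℝ φ p := by
    ext
    · simp [chW, chA, h1]
    · simp [chW, chB, h2, pdx]
  rw [heq]
  exact hd

end CHHelpers

theorem statement3 (m : ℝ) (U : Set (ℝ × ℝ)) (hU : IsOpen U)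
    (u : ℝ × ℝ → ℝ) (hu : ContDiffOn ℝ (⊤ : ℕ∞) u U)
    (hCH : ∀ p ∈ U, CamassaHolm m u p) :
    ∀ p₀ ∈ U, ∀ c : ℝ,
      (∃ V : Set (ℝ × ℝ), IsOpen V ∧ p₀ ∈ V ∧ V ⊆ U ∧
        ∃ φ₀ : ℝ × ℝ → ℝ, ContDiffOn ℝ (⊤ : ℕ∞) φ₀ V ∧ φ₀ p₀ = c ∧ CHAngleSystem m u φ₀ V) ∧
      (∀ W : Set (ℝ × ℝ), IsOpen W → IsConnected W → p₀ ∈ W → W ⊆ U →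
        ∀ φ ψ : ℝ × ℝ → ℝ,
          ContDiffOn ℝ (⊤ : ℕ∞) φ W → CHAngleSystem m u φ W →
          ContDiffOn ℝ (⊤ : ℕ∞) ψ W → CHAngleSystem m u ψ W →
          φ p₀ = ψ p₀ → Set.EqOn φ ψ W) := by
  intro p₀ hp₀ c
  have hΩ : IsOpen (U ×ˢ (Set.univ : Set ℝ)) := hU.prod isOpen_univ
  have hW := chW_smooth m hU hu
  have hW2 : ContDiffOn ℝ 2 (chW m u) (U ×ˢ Set.univ) := contDiffOn_infty.1 hW 2
  refine ⟨?_, ?_⟩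
  · obtain ⟨V, hV, hpV, φ, hφ0, hφ⟩ := frob_exists (chW m u) _ hΩ hW2 (chW_compat m hU hu hCH) p₀ c
      ⟨hp₀, trivial⟩
    refine ⟨V, hV, hpV, fun p hp => (hφ p hp).1.1, φ, frob_smooth _ _ hW V hV φ hφ, hφ0, ?_⟩
    intro p hp
    unfold pdt
    rw [show pdx φ p = fderiv ℝ φ p (1, 0) from rfl, (hφ p hp).2.fderiv]
    constructor
    · simp [chW, chA]
    · simp [chW, chB]
  · intro W hWo hWc hpW hWU φ ψ hφ hφs hψ hψs h0
    exact frob_unique_s3 (chW m u) _ hΩ hW2 W hWo hWc.isPreconnected p₀ hpW φ ψ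
      (sys_iff m hWU hWo hφ hφs) (sys_iff m hWU hWo hψ hψs) h0
end

section
/- Let m ∈ ℝ, let U ⊆ ℝ² be open with coordinates (x,t), let u : U → ℝ be a smooth solution of the Camassa–Holm equation u_t − u_xxt = u u_xxx + 2 u_x u_xx − 3 u u_x − m u_x, set h = u − u_xx + m/2, and let φ₀ : U → ℝ be a differentiable function satisfying ∂φ₀/∂x = (h − 1) sin φ₀ + h and ∂φ₀/∂t = u_x cos φ₀ − (uh + m/2 − 1) sin φ₀ − u(h + 1) − m/2 on U. Then the 1-form (h − 1) cos φ₀ dx + [(−uh + 1 − m/2) cos φ₀ − u_x sin φ₀] dt is closed, i.e. ∂/∂t [(h − 1) cos φ₀] = ∂/∂x [(−uh + 1 − m/2) cos φ₀ − u_x sin φ₀] at every point of U. -/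
open Real

theorem smooth_pdx {U : Set (ℝ × ℝ)} (hU : IsOpen U) {f : ℝ × ℝ → ℝ}
    (hf : ContDiffOn ℝ (⊤ : ℕ∞) f U) : ContDiffOn ℝ (⊤ : ℕ∞) (pdx f) U := by
  have h := hf.fderiv_of_isOpen (m := (⊤ : ℕ∞)) hU (by simp)
  exact h.clm_apply contDiffOn_const

theorem smooth_hasF {U : Set (ℝ × ℝ)} (hU : IsOpen U) {f : ℝ × ℝ → ℝ}
    (hf : ContDiffOn ℝ (⊤ : ℕ∞) f U) {p : ℝ × ℝ} (hp : p ∈ U) :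
    HasFDerivAt f (fderiv ℝ f p) p :=
  ((hf.contDiffAt (hU.mem_nhds hp)).differentiableAt (by simp)).hasFDerivAt

theorem statement4 (m : ℝ) (U : Set (ℝ × ℝ)) (hU : IsOpen U)
    (u : ℝ × ℝ → ℝ) (hu : ContDiffOn ℝ (⊤ : ℕ∞) u U)
    (hCH : ∀ p ∈ U, CamassaHolm m u p)
    (φ₀ : ℝ × ℝ → ℝ)
    (hφ₀ : ∀ p ∈ U, DifferentiableAt ℝ φ₀ p)
    (hφ₀x : ∀ p ∈ U, pdx φ₀ p = (chH m u p - 1) * sin (φ₀ p) + chH m u p)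
    (hφ₀t : ∀ p ∈ U, pdt φ₀ p = pdx u p * cos (φ₀ p)
      - (u p * chH m u p + m / 2 - 1) * sin (φ₀ p) - u p * (chH m u p + 1) - m / 2) :
    ∀ p ∈ U,
      pdt (fun q => (chH m u q - 1) * cos (φ₀ q)) p =
        pdx (fun q => (-(u q * chH m u q) + 1 - m / 2) * cos (φ₀ q)
          - pdx u q * sin (φ₀ q)) p := by
  intro p hp
  have h0 := smooth_hasF hU hu hp
  have h1 := smooth_hasF hU (smooth_pdx hU hu) hp
  have h2 := smooth_hasF hU (smooth_pdx hU (smooth_pdx hU hu)) hp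
  have hf := (hφ₀ p hp).hasFDerivAt
  have hh : HasFDerivAt (chH m u) (fderiv ℝ u p - fderiv ℝ (pdx (pdx u)) p) p :=
    (h0.sub h2).add_const (m / 2)
  have hL := (hh.sub_const 1).mul hf.cos
  have hR := ((((h0.mul hh).neg.add_const 1).sub_const (m / 2)).mul hf.cos).sub (h1.mul hf.sin)
  have eL : pdt (fun q => (chH m u q - 1) * cos (φ₀ q)) p = _ :=
    congrArg (fun L : ℝ × ℝ →L[ℝ] ℝ => L (0, 1)) (HasFDerivAt.fderiv hL)
  have eR : pdx (fun q => (-(u q * chH m u q) + 1 - m / 2) * cos (φ₀ q)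
          - pdx u q * sin (φ₀ q)) p = _ :=
    congrArg (fun L : ℝ × ℝ →L[ℝ] ℝ => L (1, 0)) (HasFDerivAt.fderiv hR)
  rw [eL, eR]
  have hc := hCH p hp
  have hx := hφ₀x p hp
  have ht := hφ₀t p hp
  unfold CamassaHolm at hc
  have a1 : ∀ f : ℝ × ℝ → ℝ, fderiv ℝ f p (1, 0) = pdx f p := fun _ => rfl
  have a2 : ∀ f : ℝ × ℝ → ℝ, fderiv ℝ f p (0, 1) = pdt f p := fun _ => rfl
  simp only [ContinuousLinearMap.add_apply, ContinuousLinearMap.sub_apply,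
    ContinuousLinearMap.neg_apply, ContinuousLinearMap.smul_apply, smul_eq_mul, a1, a2,
    Pi.mul_apply, Pi.neg_apply, hx, ht]
  simp only [chH]
  linear_combination (cos (φ₀ p)) * hc
end

section
/- Let m ∈ ℝ, let U ⊆ ℝ² be open with coordinates (x,t), let u : U → ℝ be a smooth solution of the Camassa–Holm equation u_t − u_xxt = u u_xxx + 2 u_x u_xx − 3 u u_x − m u_x, set h = u − u_xx + m/2, and let φ₀ : U → ℝ be a smooth solution of ∂φ₀/∂x = (h − 1) sin φ₀ + h and ∂φ₀/∂t = u_x cos φ₀ − (uh + m/2 − 1) sin φ₀ − u(h + 1) − m/2. Then for every p₀ ∈ U and every c ∈ ℝ there exist an open neighborhood V ⊆ U of p₀ and a smooth φ₁ : V → ℝ with φ₁(p₀) = c satisfying ∂φ₁/∂x = [(h − 1) φ₁ + 1] cos φ₀ and ∂φ₁/∂t = −[(uh − 1 + m/2) cos φ₀ + u_x sin φ₀] φ₁ − (u + 1) cos φ₀ + u_x (sin φ₀ + 1) on V. -/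
open Real

lemma poincare_aux (B : Set (ℝ × ℝ)) (hB : IsOpen B) (hc : Convex ℝ B) (P Q : ℝ × ℝ → ℝ)
    (hP : ContDiffOn ℝ (⊤ : ℕ∞) P B) (hQ : ContDiffOn ℝ (⊤ : ℕ∞) Q B)
    (h : ∀ p ∈ B, pdt P p = pdx Q p) :
    ∃ F : ℝ × ℝ → ℝ, ContDiffOn ℝ (⊤ : ℕ∞) F B ∧ ∀ p ∈ B, pdx F p = P p ∧ pdt F p = Q p := by
  set ω : ℝ × ℝ → (ℝ × ℝ →L[ℝ] ℝ) := fun p =>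
    P p • ContinuousLinearMap.fst ℝ ℝ ℝ + Q p • ContinuousLinearMap.snd ℝ ℝ ℝ with hω
  have hωs : ContDiffOn ℝ (⊤ : ℕ∞) ω B :=
    (hP.smul contDiffOn_const).add (hQ.smul contDiffOn_const)
  obtain ⟨F, hF⟩ := hc.exists_forall_hasFDerivAt_of_fderiv_symmetric hB
    (hωs.differentiableOn (by simp)) (by
      intro a ha x y
      have hPa := ((hP.differentiableOn (by simp)).differentiableAt (hB.mem_nhds ha)).hasFDerivAt
      have hQa := ((hQ.differentiableOn (by simp)).differentiableAt (hB.mem_nhds ha)).hasFDerivAt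
      have h1 := (hPa.smul_const (ContinuousLinearMap.fst ℝ ℝ ℝ)).add
        (hQa.smul_const (ContinuousLinearMap.snd ℝ ℝ ℝ))
      have h2 : fderiv ℝ ω a = _ := h1.fderiv
      have h3 := h a ha
      simp only [pdt, pdx] at h3
      have key : ∀ (L : ℝ × ℝ →L[ℝ] ℝ) (z : ℝ × ℝ), L z = z.1 * L (1, 0) + z.2 * L (0, 1) := by
        intro L z
        have : z = z.1 • ((1 : ℝ), (0 : ℝ)) + z.2 • ((0 : ℝ), (1 : ℝ)) := by ext <;> simp
        conv_lhs => rw [this]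
        rw [map_add, map_smul, map_smul]; simp
      rw [h2]
      simp only [ContinuousLinearMap.add_apply, ContinuousLinearMap.smulRight_apply,
        ContinuousLinearMap.smul_apply, ContinuousLinearMap.coe_fst', ContinuousLinearMap.coe_snd',
        smul_eq_mul]
      rw [key _ x, key _ y, key (fderiv ℝ Q a) x, key (fderiv ℝ Q a) y, h3]
      ring)
  refine ⟨F, ?_, ?_⟩
  · refine (contDiffOn_infty_iff_fderiv_of_isOpen hB).2
      ⟨fun p hp => (hF p hp).differentiableAt.differentiableWithinAt, ?_⟩
    exact hωs.congr fun p hp => (hF p hp).fderiv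
  · intro p hp
    simp [pdx, pdt, (hF p hp).fderiv, hω]

lemma smooth_dir {U : Set (ℝ × ℝ)} (hU : IsOpen U) {f : ℝ × ℝ → ℝ}
    (hf : ContDiffOn ℝ (⊤ : ℕ∞) f U) (v : ℝ × ℝ) :
    ContDiffOn ℝ (⊤ : ℕ∞) (fun p => fderiv ℝ f p v) U :=
  ((contDiffOn_infty_iff_fderiv_of_isOpen hU).1 hf).2.clm_apply contDiffOn_const

lemma linear_aux (B : Set (ℝ × ℝ)) (hB : IsOpen B) (hc : Convex ℝ B) (a b A C : ℝ × ℝ → ℝ)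
    (ha : ContDiffOn ℝ (⊤ : ℕ∞) a B) (hb : ContDiffOn ℝ (⊤ : ℕ∞) b B)
    (hA : ContDiffOn ℝ (⊤ : ℕ∞) A B) (hC : ContDiffOn ℝ (⊤ : ℕ∞) C B)
    (h1 : ∀ p ∈ B, pdt a p = pdx A p)
    (h2 : ∀ p ∈ B, a p * C p + pdt b p = A p * b p + pdx C p)
    (p₀ : ℝ × ℝ) (c : ℝ) :
    ∃ φ : ℝ × ℝ → ℝ, ContDiffOn ℝ (⊤ : ℕ∞) φ B ∧ φ p₀ = c ∧
      ∀ p ∈ B, pdx φ p = a p * φ p + b p ∧ pdt φ p = A p * φ p + C p := by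
  have D : ∀ {f : ℝ × ℝ → ℝ}, ContDiffOn ℝ (⊤ : ℕ∞) f B → ∀ p ∈ B,
      HasFDerivAt f (fderiv ℝ f p) p := fun hf p hp =>
    ((hf.differentiableOn (by simp)).differentiableAt (hB.mem_nhds hp)).hasFDerivAt
  obtain ⟨F, hF, hFd⟩ := poincare_aux B hB hc a A ha hA h1
  have hE : ContDiffOn ℝ (⊤ : ℕ∞) (fun p => Real.exp (-F p)) B := hF.neg.exp
  obtain ⟨G, hG, hGd⟩ := poincare_aux B hB hc (fun p => Real.exp (-F p) * b p)
    (fun p => Real.exp (-F p) * C p) (hE.mul hb) (hE.mul hC) (by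
      intro p hp
      have e1 := ((D hF p hp).neg.exp.mul (D hb p hp)).fderiv
      have e2 := ((D hF p hp).neg.exp.mul (D hC p hp)).fderiv
      obtain ⟨d1, d2⟩ := hFd p hp
      have d3 := h2 p hp
      simp only [pdx, pdt] at d1 d2 d3 ⊢
      erw [e1, e2]
      simp [d1, d2]
      linear_combination Real.exp (-F p) * d3)
  refine ⟨fun p => Real.exp (F p) * (G p + (c * Real.exp (-F p₀) - G p₀)), ?_, ?_, ?_⟩
  · exact hF.exp.mul (hG.add contDiffOn_const)
  · have : Real.exp (F p₀) * Real.exp (-F p₀) = 1 := by rw [← Real.exp_add]; simp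
    linear_combination c * this
  · intro p hp
    have e := ((D hF p hp).exp.mul ((D hG p hp).add_const (c * Real.exp (-F p₀) - G p₀))).fderiv
    obtain ⟨d1, d2⟩ := hFd p hp
    obtain ⟨g1, g2⟩ := hGd p hp
    have : Real.exp (F p) * Real.exp (-F p) = 1 := by rw [← Real.exp_add]; simp
    simp only [pdx, pdt] at d1 d2 g1 g2 ⊢
    erw [e]
    simp [d1, d2, g1, g2]
    constructor
    · linear_combination b p * this
    · linear_combination C p * this

theorem statement5 (m : ℝ) (U : Set (ℝ × ℝ)) (hU : IsOpen U)
    (u : ℝ × ℝ → ℝ) (hu : ContDiffOn ℝ (⊤ : ℕ∞) u U)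
    (hCH : ∀ p ∈ U, CamassaHolm m u p)
    (φ₀ : ℝ × ℝ → ℝ) (hφ₀ : ContDiffOn ℝ (⊤ : ℕ∞) φ₀ U)
    (hφ₀x : ∀ p ∈ U, pdx φ₀ p = (chH m u p - 1) * sin (φ₀ p) + chH m u p)
    (hφ₀t : ∀ p ∈ U, pdt φ₀ p = pdx u p * cos (φ₀ p)
      - (u p * chH m u p + m / 2 - 1) * sin (φ₀ p) - u p * (chH m u p + 1) - m / 2) :
    ∀ p₀ ∈ U, ∀ c : ℝ,
      ∃ V : Set (ℝ × ℝ), IsOpen V ∧ p₀ ∈ V ∧ V ⊆ U ∧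
        ∃ φ₁ : ℝ × ℝ → ℝ, ContDiffOn ℝ (⊤ : ℕ∞) φ₁ V ∧ φ₁ p₀ = c ∧
          ∀ p ∈ V,
            pdx φ₁ p = ((chH m u p - 1) * φ₁ p + 1) * cos (φ₀ p) ∧
            pdt φ₁ p = -((u p * chH m u p - 1 + m / 2) * cos (φ₀ p)
                + pdx u p * sin (φ₀ p)) * φ₁ p
              - (u p + 1) * cos (φ₀ p) + pdx u p * (sin (φ₀ p) + 1) := by
  intro p₀ hp₀ c
  obtain ⟨r, hr, hrU⟩ := Metric.isOpen_iff.1 hU p₀ hp₀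
  have hB : IsOpen (Metric.ball p₀ r) := Metric.isOpen_ball
  have hux : ContDiffOn ℝ (⊤ : ℕ∞) (pdx u) U := smooth_dir hU hu _
  have huxx : ContDiffOn ℝ (⊤ : ℕ∞) (pdx (pdx u)) U := smooth_dir hU hux _
  have hh : ContDiffOn ℝ (⊤ : ℕ∞) (chH m u) U := (hu.sub huxx).add contDiffOn_const
  have hcos : ContDiffOn ℝ (⊤ : ℕ∞) (fun p => cos (φ₀ p)) U := hφ₀.cos
  have hsin : ContDiffOn ℝ (⊤ : ℕ∞) (fun p => sin (φ₀ p)) U := hφ₀.sin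
  have D : ∀ {f : ℝ × ℝ → ℝ}, ContDiffOn ℝ (⊤ : ℕ∞) f U → ∀ p ∈ U,
      HasFDerivAt f (fderiv ℝ f p) p := fun hf p hp =>
    ((hf.differentiableOn (by simp)).differentiableAt (hU.mem_nhds hp)).hasFDerivAt
  obtain ⟨φ, h1, h2, h3⟩ := linear_aux (Metric.ball p₀ r) hB (convex_ball _ _)
    (fun p => (chH m u p - 1) * cos (φ₀ p)) (fun p => cos (φ₀ p))
    (fun p => -((u p * chH m u p - 1 + m / 2) * cos (φ₀ p) + pdx u p * sin (φ₀ p)))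
    (fun p => -((u p + 1) * cos (φ₀ p)) + pdx u p * (sin (φ₀ p) + 1))
    (((hh.sub contDiffOn_const).mul hcos).mono hrU)
    (hcos.mono hrU)
    ((((((hu.mul hh).sub contDiffOn_const).add contDiffOn_const).mul hcos).add
      (hux.mul hsin)).neg.mono hrU)
    ((((hu.add contDiffOn_const).mul hcos).neg.add
      (hux.mul (hsin.add contDiffOn_const))).mono hrU)
    (by
      intro p hp'
      have hp := hrU hp'
      have e0 := (((D hu p hp).sub (D huxx p hp)).add_const (m / 2)).fderiv
      have e1 := (((D hh p hp).sub_const 1).mul (D hφ₀ p hp).cos).fderiv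
      have e2 := ((((((D hu p hp).mul (D hh p hp)).sub_const 1).add_const (m / 2)).mul
        (D hφ₀ p hp).cos).add ((D hux p hp).mul (D hφ₀ p hp).sin)).neg.fderiv
      have ct : pdt (chH m u) p = pdt u p - pdt (pdx (pdx u)) p :=
        congrArg (fun L : ℝ × ℝ →L[ℝ] ℝ => L (0, 1)) e0
      have cx : pdx (chH m u) p = pdx u p - pdx (pdx (pdx u)) p :=
        congrArg (fun L : ℝ × ℝ →L[ℝ] ℝ => L (1, 0)) e0
      have d1 := hφ₀x p hp
      have d2 := hφ₀t p hp
      have d3 := hCH p hp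
      have d4 : chH m u p = u p - pdx (pdx u) p + m / 2 := rfl
      unfold CamassaHolm at d3
      rw [← ct] at d3
      have f1 := congrArg (fun L : ℝ × ℝ →L[ℝ] ℝ => L (0, 1)) e1
      have f2 := congrArg (fun L : ℝ × ℝ →L[ℝ] ℝ => L (1, 0)) e2
      refine f1.trans (Eq.trans ?_ f2.symm)
      simp
      have g1 : fderiv ℝ φ₀ p (0, 1) = pdt φ₀ p := rfl
      have g2 : fderiv ℝ φ₀ p (1, 0) = pdx φ₀ p := rfl
      have g3 : fderiv ℝ (chH m u) p (0, 1) = pdt (chH m u) p := rfl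
      have g4 : fderiv ℝ (chH m u) p (1, 0) = pdx (chH m u) p := rfl
      have g5 : fderiv ℝ u p (1, 0) = pdx u p := rfl
      have g6 : fderiv ℝ (pdx u) p (1, 0) = pdx (pdx u) p := rfl
      rw [g1, g2, g3, g4, g5, g6, d1, d2, d3, cx]
      rw [d4]
      ring)
    (by
      intro p hp'
      have hp := hrU hp'
      have e1 := (D hφ₀ p hp).cos.fderiv
      have e2 := ((((D hu p hp).add_const 1).mul (D hφ₀ p hp).cos).neg.add
        ((D hux p hp).mul ((D hφ₀ p hp).sin.add_const 1))).fderiv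
      have d1 := hφ₀x p hp
      have d2 := hφ₀t p hp
      have d4 : chH m u p = u p - pdx (pdx u) p + m / 2 := rfl
      have f1 := congrArg (fun L : ℝ × ℝ →L[ℝ] ℝ => L (0, 1)) e1
      have f2 := congrArg (fun L : ℝ × ℝ →L[ℝ] ℝ => L (1, 0)) e2
      have g1 : fderiv ℝ φ₀ p (0, 1) = pdt φ₀ p := rfl
      have g2 : fderiv ℝ φ₀ p (1, 0) = pdx φ₀ p := rfl
      have g5 : fderiv ℝ u p (1, 0) = pdx u p := rfl
      have g6 : fderiv ℝ (pdx u) p (1, 0) = pdx (pdx u) p := rfl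
      refine (congrArg₂ (· + ·) rfl f1).trans (Eq.trans ?_ (congrArg₂ (· + ·) rfl f2).symm)
      simp
      rw [g1, g2, g5, g6, d1, d2, d4]
      have := sin_sq_add_cos_sq (φ₀ p)
      linear_combination (pdx (pdx u) p) * this)
    p₀ c
  refine ⟨_, hB, Metric.mem_ball_self hr, hrU, φ, h1, h2, fun p hp => ?_⟩
  obtain ⟨k1, k2⟩ := h3 p hp
  exact ⟨by rw [k1]; ring, by rw [k2]; ring⟩
end

section
/- Let U ⊆ ℝ² be open with coordinates (x₁,x₂) and let u : U → ℝ be smooth. Define V₁ = cos(u/2), V₂ = sin(u/2), h₁₂ = u_{x₁}/2 and h₂₁ = −u_{x₂}/2. Then the pair {V, h} satisfies the Intrinsic Generalized sine-Gordon equations for n = 2 (namely V₁² + V₂² = 1, ∂V₁/∂x₂ = V₂ h₂₁, ∂V₂/∂x₁ = V₁ h₁₂, ∂h₁₂/∂x₁ + ∂h₂₁/∂x₂ = V₁V₂, and ∂h₂₁/∂x₂ + ∂h₁₂/∂x₁ = V₂V₁) at every point of U if and only if u satisfies the sine-Gordon equation u_{x₁x₁} − u_{x₂x₂} = sin u at every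 point of U. -/
open Real

/-- Partial derivative in the first (`x₁`) coordinate. -/
noncomputable def pd1 (f : ℝ × ℝ → ℝ) : ℝ × ℝ → ℝ := fun p => fderiv ℝ f p (1, 0)

/-- Partial derivative in the second (`x₂`) coordinate. -/
noncomputable def pd2 (f : ℝ × ℝ → ℝ) : ℝ × ℝ → ℝ := fun p => fderiv ℝ f p (0, 1)

theorem aux_fderiv_smul (f : ℝ × ℝ → ℝ) (c : ℝ) (p : ℝ × ℝ) :
    fderiv ℝ (fun q => c * f q) p = c • fderiv ℝ f p := by
  exact congrFun (fderiv_const_smul_field (𝕜 := ℝ) (f := f) c) p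

theorem statement8 (U : Set (ℝ × ℝ)) (hU : IsOpen U)
    (u : ℝ × ℝ → ℝ) (hu : ContDiffOn ℝ (⊤ : ℕ∞) u U) :
    (∀ p ∈ U,
      cos (u p / 2) ^ 2 + sin (u p / 2) ^ 2 = 1 ∧
      pd2 (fun q => cos (u q / 2)) p = sin (u p / 2) * (-(pd2 u p) / 2) ∧
      pd1 (fun q => sin (u q / 2)) p = cos (u p / 2) * (pd1 u p / 2) ∧
      pd1 (fun q => pd1 u q / 2) p + pd2 (fun q => -(pd2 u q) / 2) p
        = cos (u p / 2) * sin (u p / 2) ∧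
      pd2 (fun q => -(pd2 u q) / 2) p + pd1 (fun q => pd1 u q / 2) p
        = sin (u p / 2) * cos (u p / 2)) ↔
    (∀ p ∈ U, pd1 (pd1 u) p - pd2 (pd2 u) p = sin (u p)) := by
  have hd : ∀ p ∈ U, DifferentiableAt ℝ u p := fun p hp =>
    (hu.contDiffAt (hU.mem_nhds hp)).differentiableAt (by simp)
  have e1 : ∀ p, pd1 (fun q => pd1 u q / 2) p = (1/2) * pd1 (pd1 u) p := by
    intro p
    have : (fun q => pd1 u q / 2) = fun q => (1/2 : ℝ) * pd1 u q := by
      funext q; ring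
    rw [this]
    simp only [pd1]
    rw [aux_fderiv_smul (fun q => fderiv ℝ u q (1, 0))]
    rfl
  have e2 : ∀ p, pd2 (fun q => -(pd2 u q) / 2) p = (-1/2) * pd2 (pd2 u) p := by
    intro p
    have : (fun q => -(pd2 u q) / 2) = fun q => (-1/2 : ℝ) * pd2 u q := by
      funext q; ring
    rw [this]
    simp only [pd2]
    rw [aux_fderiv_smul (fun q => fderiv ℝ u q (0, 1))]
    rfl
  have e3 : ∀ p, sin (u p) = 2 * sin (u p / 2) * cos (u p / 2) := by
    intro p
    rw [← Real.sin_two_mul]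
    congr 1; ring
  have half : ∀ p ∈ U, HasFDerivAt (fun q => u q / 2) ((1/2 : ℝ) • fderiv ℝ u p) p := by
    intro p hp
    have h := (hd p hp).hasFDerivAt.const_smul (1/2 : ℝ)
    refine h.congr_of_eventuallyEq (Filter.Eventually.of_forall fun q => ?_)
    simp only [Pi.smul_apply, smul_eq_mul]
    ring
  constructor
  · intro h p hp
    obtain ⟨-, -, -, h4, -⟩ := h p hp
    rw [e1, e2] at h4
    rw [e3]
    linarith
  · intro h p hp
    have h4 := h p hp
    rw [e3] at h4
    refine ⟨Real.cos_sq_add_sin_sq _, ?_, ?_, ?_, ?_⟩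
    · simp only [pd2]
      rw [(half p hp).cos.fderiv]
      simp only [smul_apply, ContinuousLinearMap.smul_apply, smul_eq_mul]
      ring
    · simp only [pd1]
      rw [(half p hp).sin.fderiv]
      simp only [smul_apply, ContinuousLinearMap.smul_apply, smul_eq_mul]
      ring
    · rw [e1, e2]; linarith
    · rw [e1, e2]; linarith
end

section
/- Let n ≥ 2 and let c₂, …, cₙ ∈ ℝ satisfy Σ_{j=2}^n c_j² = 1. On the open set U = { x ∈ ℝⁿ : x₁ > 0 } define V₁(x) = tanh x₁, V_j(x) = c_j / cosh x₁ for 2 ≤ j ≤ n, and define the off-diagonal functions h_{1j} = −V_j for 2 ≤ j ≤ n and h_{ij} = 0 for all other pairs i ≠ j. Then the pair {V, h} satisfies the Intrinsic Generalized sine-Gordon equations on U: Σᵢ Vᵢ² = 1; ∂Vᵢ/∂x_j = V_j h_{ji} for all i ≠ j; ∂h_{ij}/∂x_i + ∂h_{ji}/∂x_j + Σ_{s ≠ i,j} h_{si} h_{sj} = Vᵢ V_j for all i ≠ j; and ∂h_{ij}/∂x_s = h_{is} h_{sj} for all distinct i, j, s. -/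
open Real

/-- Partial derivative of `f : ℝⁿ → ℝ` in the `m`-th coordinate direction. -/
noncomputable def pd {n : ℕ} (m : Fin n) (f : (Fin n → ℝ) → ℝ) (x : Fin n → ℝ) : ℝ :=
  fderiv ℝ f x (Pi.single m 1)

/-- The Intrinsic Generalized sine-Gordon equations for the pair `{V, h}` on `U`. -/
def IGSGE (n : ℕ) (U : Set (Fin n → ℝ)) (V : (Fin n → ℝ) → Fin n → ℝ)
    (h : (Fin n → ℝ) → Fin n → Fin n → ℝ) : Prop :=
  ∀ x ∈ U,
    (∑ i, V x i ^ 2 = 1) ∧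
    (∀ i j, i ≠ j → pd j (fun y => V y i) x = V x j * h x j i) ∧
    (∀ i j, i ≠ j →
      pd i (fun y => h y i j) x + pd j (fun y => h y j i) x +
        ∑ s ∈ Finset.univ.filter (fun s => s ≠ i ∧ s ≠ j), h x s i * h x s j
      = V x i * V x j) ∧
    (∀ i j s : Fin n, i ≠ j → i ≠ s → j ≠ s →
      pd s (fun y => h y i j) x = h x i s * h x s j)

theorem pd_comp {n : ℕ} [NeZero n] (m : Fin n) (g : ℝ → ℝ) (g' : ℝ) (x : Fin n → ℝ)
    (hg : HasDerivAt g g' (x 0)) :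
    pd m (fun y => g (y 0)) x = if m = 0 then g' else 0 := by
  have h1 : HasFDerivAt (fun y : Fin n → ℝ => y 0)
      (ContinuousLinearMap.proj (R := ℝ) (φ := fun _ : Fin n => ℝ) 0) x :=
    hasFDerivAt_apply 0 x
  have h2 := hg.comp_hasFDerivAt x h1
  have h3 : fderiv ℝ (fun y : Fin n → ℝ => g (y 0)) x = _ := h2.fderiv
  unfold pd
  rw [h3]
  by_cases hm : m = 0
  · subst hm; simp
  · simp [hm, Pi.single_apply, Ne.symm hm]

theorem hasDerivAt_sech (c t : ℝ) :
    HasDerivAt (fun t => c / Real.cosh t) (-(c * Real.sinh t / Real.cosh t ^ 2)) t := by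
  have h := (hasDerivAt_const t c).div (Real.hasDerivAt_cosh t) (Real.cosh_pos t).ne'
  refine h.congr_deriv ?_
  ring

theorem hasDerivAt_tanh_aux (t : ℝ) : ∃ d, HasDerivAt Real.tanh d t := by
  have h := (Real.hasDerivAt_sinh t).div (Real.hasDerivAt_cosh t) (Real.cosh_pos t).ne'
  refine ⟨_, h.congr_of_eventuallyEq (Filter.Eventually.of_forall fun y => ?_)⟩
  exact Real.tanh_eq_sinh_div_cosh y

theorem pd_V {n : ℕ} [NeZero n] (m : Fin n) (c : ℝ) (x : Fin n → ℝ) :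
    pd m (fun y => c / Real.cosh (y 0)) x =
      if m = 0 then -(c * Real.sinh (x 0) / Real.cosh (x 0) ^ 2) else 0 :=
  pd_comp m _ _ x (hasDerivAt_sech c (x 0))

theorem pd_h {n : ℕ} [NeZero n] (m : Fin n) (c : ℝ) (x : Fin n → ℝ) :
    pd m (fun y => -(c / Real.cosh (y 0))) x =
      if m = 0 then - -(c * Real.sinh (x 0) / Real.cosh (x 0) ^ 2) else 0 :=
  pd_comp m (fun t => -(c / Real.cosh t)) _ x (hasDerivAt_sech c (x 0)).neg

theorem pd_tanh {n : ℕ} [NeZero n] (m : Fin n) (hm : m ≠ 0) (x : Fin n → ℝ) :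
    pd m (fun y => Real.tanh (y 0)) x = 0 := by
  obtain ⟨d, hd⟩ := hasDerivAt_tanh_aux (x 0)
  rw [pd_comp m _ _ x hd, if_neg hm]

theorem pd_zero {n : ℕ} (m : Fin n) (x : Fin n → ℝ) :
    pd m (fun _ => (0 : ℝ)) x = 0 := by
  simp [pd]

theorem statement9 (n : ℕ) (hn : 2 ≤ n) [NeZero n] (c : Fin n → ℝ)
    (hc : ∑ j ∈ Finset.univ.filter (fun j => j ≠ (0 : Fin n)), c j ^ 2 = 1) :
    IGSGE n {x | x 0 > 0}
      (fun x i => if i = 0 then Real.tanh (x 0) else c i / Real.cosh (x 0))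
      (fun x i j => if i = 0 ∧ j ≠ 0 then -(c j / Real.cosh (x 0)) else 0) := by
  intro x _
  have hC : Real.cosh (x 0) ≠ 0 := (Real.cosh_pos _).ne'
  refine ⟨?_, ?_, ?_, ?_⟩
  · rw [← Finset.add_sum_erase _ _ (Finset.mem_univ (0 : Fin n))]
    have h1 : ∑ i ∈ Finset.univ.erase (0 : Fin n),
        (if i = 0 then Real.tanh (x 0) else c i / Real.cosh (x 0)) ^ 2
        = 1 / Real.cosh (x 0) ^ 2 := by
      rw [← hc, Finset.sum_div]
      refine Finset.sum_congr (by ext; simp) fun i hi => ?_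
      have : i ≠ 0 := by simpa using hi
      simp [this, div_pow]
    simp only [if_true]
    rw [h1, Real.tanh_eq_sinh_div_cosh]
    field_simp
    rw [Real.cosh_sq]
  · intro i j hij
    by_cases hi : i = 0
    · subst hi
      simp [pd_tanh j (Ne.symm hij)]
    · by_cases hj : j = 0
      · subst hj
        simp only [hi, if_false, pd_V, if_true, Real.tanh_eq_sinh_div_cosh]
        simp [hi]
        field_simp
      · simp [hi, hj, pd_V]
  · intro i j hij
    by_cases hi : i = 0
    · subst hi
      have hj : j ≠ 0 := Ne.symm hij
      rw [Finset.sum_eq_zero (by intro s hs; simp)]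
      simp [hj, pd_h, pd_zero, Real.tanh_eq_sinh_div_cosh]
      field_simp
    · by_cases hj : j = 0
      · subst hj
        rw [Finset.sum_eq_zero (by intro s hs; simp)]
        simp [hi, pd_h, pd_zero, Real.tanh_eq_sinh_div_cosh]
        field_simp
      · rw [Finset.sum_eq_single (0 : Fin n)]
        · simp [hi, hj, pd_zero]
        · intro s _ hs
          simp [hs]
        · intro h
          exact absurd (Finset.mem_filter.2 ⟨Finset.mem_univ _, Ne.symm hi, Ne.symm hj⟩) h
  · intro i j s hij his hjs
    by_cases hi : i = 0
    · subst hi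
      simp [Ne.symm hij, Ne.symm his, pd_h]
    · simp [hi, pd_zero]
end

section
/- Let U ⊆ ℝ² be open with coordinates (x₁,x₂), let u : U → ℝ be a smooth solution of the sine-Gordon equation u_{x₁x₁} − u_{x₂x₂} = sin u, and let φ : U → ℝ be a differentiable function satisfying φ_{x₁} = u_{x₂}/2 + sin φ · cos(u/2) and φ_{x₂} = u_{x₁}/2 + cos φ · sin(u/2) on U. Then the 1-form cos φ cos(u/2) dx₁ − sin φ sin(u/2) dx₂ is closed, i.e. ∂/∂x₂ [cos φ cos(u/2)] = ∂/∂x₁ [− sin φ sin(u/2)] at every point of U. -/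
open Real

theorem statement11 (U : Set (ℝ × ℝ)) (hU : IsOpen U)
    (u : ℝ × ℝ → ℝ) (hu : ContDiffOn ℝ (⊤ : ℕ∞) u U)
    (hSG : ∀ p ∈ U, pd1 (pd1 u) p - pd2 (pd2 u) p = sin (u p))
    (φ : ℝ × ℝ → ℝ)
    (hφ : ∀ p ∈ U, DifferentiableAt ℝ φ p)
    (hφ1 : ∀ p ∈ U, pd1 φ p = pd2 u p / 2 + sin (φ p) * cos (u p / 2))
    (hφ2 : ∀ p ∈ U, pd2 φ p = pd1 u p / 2 + cos (φ p) * sin (u p / 2)) :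
    ∀ p ∈ U,
      pd2 (fun q => cos (φ q) * cos (u q / 2)) p =
        pd1 (fun q => -(sin (φ q) * sin (u q / 2))) p := by
  intro p hp
  have hd : DifferentiableAt ℝ u p :=
    (hu.differentiableOn (by simp)).differentiableAt (hU.mem_nhds hp)
  have h1 := hφ1 p hp
  have h2 := hφ2 p hp
  have Hu := hd.hasFDerivAt.mul_const (2⁻¹ : ℝ)
  have Hφ := (hφ p hp).hasFDerivAt
  have A := (Hφ.cos.mul Hu.cos).fderiv
  have B := (Hφ.sin.mul Hu.sin).neg.fderiv
  have A' : pd2 (fun q => cos (φ q) * cos (u q / 2)) p =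
      cos (φ p) * (-sin (u p / 2) * (pd2 u p / 2)) +
        cos (u p / 2) * (-sin (φ p) * pd2 φ p) := by
    have := congrArg (fun L => L (0, 1)) A
    simp only [div_eq_mul_inv, pd2]
    refine this.trans ?_
    simp only [ContinuousLinearMap.add_apply, ContinuousLinearMap.smul_apply, ContinuousLinearMap.neg_apply, smul_eq_mul]
    ring
  have B' : pd1 (fun q => -(sin (φ q) * sin (u q / 2))) p =
      -(sin (φ p) * (cos (u p / 2) * (pd1 u p / 2)) +
        sin (u p / 2) * (cos (φ p) * pd1 φ p)) := by
    have := congrArg (fun L => L (1, 0)) B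
    simp only [div_eq_mul_inv, pd1]
    refine this.trans ?_
    simp only [ContinuousLinearMap.add_apply, ContinuousLinearMap.smul_apply, ContinuousLinearMap.neg_apply, smul_eq_mul]
    ring
  rw [A', B', h1, h2]
  ring
end

section
/- Let n ≥ 2, let U ⊆ ℝⁿ be open, and let smooth functions a_{ik} : U → ℝ (1 ≤ i,k ≤ n) and b_{ijm} : U → ℝ (1 ≤ i,j,m ≤ n) with b_{ijm} = −b_{jim} satisfy, for all indices i, j and all l, m: ∂_l a_{im} − ∂_m a_{il} = Σ_j (a_{jl} b_{jim} − a_{jm} b_{jil}) and ∂_l b_{ijm} − ∂_m b_{ijl} = Σ_k (b_{ikl} b_{kjm} − b_{ikm} b_{kjl}) + a_{il} a_{jm} − a_{im} a_{jl}. Let L : U → Matrix (n×n, ℝ) be smooth with L(x) L(x)ᵀ = I for all x ∈ U, and suppose that for every coordinate index m: (a) for every i ≠ 1, Σ_k (∂_m L_{1k}) L_{ik} + Σ_{k,l} L_{1k} b_{klm} L_{il} + Σ_k L_{ik} a_{km} = 0, and (b) for all distinct i, j with i ≠ 1 and j ≠ 1, Σ_k (∂_m L_{ik}) L_{jk} +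 Σ_{k,l} L_{ik} b_{klm} L_{jl} = 0. Then the functions g_m := Σ_k L_{1k} a_{km} satisfy ∂_l g_m = ∂_m g_l for all l, m; that is, the 1-form Σ_m g_m dx_m is closed. -/
open Real Matrix

theorem s13_row {n : ℕ} [NeZero n] (L : Matrix (Fin n) (Fin n) ℝ) (hL : L * Lᵀ = 1)
    (D A : Fin n → ℝ) (B : Fin n → Fin n → ℝ) (hB : ∀ i j, B i j = - B j i)
    (h0 : ∑ k, D k * L 0 k = 0)
    (hA : ∀ i : Fin n, i ≠ 0 → (∑ k, D k * L i k) + (∑ k, ∑ l, L 0 k * B k l * L i l)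
      + (∑ k, L i k * A k) = 0) (p : Fin n) :
    D p = - (∑ k, L 0 k * B k p) - A p + L 0 p * ∑ k, L 0 k * A k := by
  set g := ∑ k, L 0 k * A k with hg
  have hskew0 : ∑ k, ∑ l, L 0 k * B k l * L 0 l = 0 := by
    have h1 : ∑ k, ∑ l, L 0 k * B k l * L 0 l = - ∑ k, ∑ l, L 0 k * B k l * L 0 l := by
      conv_lhs => rw [Finset.sum_comm]
      rw [← Finset.sum_neg_distrib]
      refine Finset.sum_congr rfl fun k _ => ?_
      rw [← Finset.sum_neg_distrib]
      refine Finset.sum_congr rfl fun l _ => ?_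
      rw [hB l k]; ring
    linarith
  have hrow : ∀ i, ∑ l, L i l * L 0 l = (1 : Matrix (Fin n) (Fin n) ℝ) i 0 := by
    intro i
    rw [← hL, Matrix.mul_apply]; rfl
  let w : Fin n → ℝ := fun l => D l + (∑ k, L 0 k * B k l) + A l - L 0 l * g
  have hw : L *ᵥ w = 0 := by
    funext i
    have e : (L *ᵥ w) i = (∑ k, D k * L i k) + (∑ k, ∑ l, L 0 k * B k l * L i l)
      + (∑ k, L i k * A k) - (∑ l, L i l * L 0 l) * g := by
      change ∑ l, L i l * w l = _
      rw [Finset.sum_comm, Finset.sum_mul, ← Finset.sum_add_distrib, ← Finset.sum_add_distrib,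
        ← Finset.sum_sub_distrib]
      refine Finset.sum_congr rfl fun l _ => ?_
      rw [← Finset.sum_mul]
      simp only [w]; ring
    rw [e, hrow]
    by_cases hi : i = 0
    · subst hi
      rw [h0, hskew0]; simp [hg]
    · rw [hA i hi]; simp [hi]
  have hw0 : w = 0 := by
    have : (Lᵀ * L) *ᵥ w = 0 := by rw [← Matrix.mulVec_mulVec, hw, Matrix.mulVec_zero]
    rwa [mul_eq_one_comm.mp hL, Matrix.one_mulVec] at this
  have := congrFun hw0 p
  simp only [w, Pi.zero_apply] at this
  linarith

theorem s13_pd_sum {n : ℕ} (m : Fin n) (f g : Fin n → (Fin n → ℝ) → ℝ) (x : Fin n → ℝ)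
    (hf : ∀ k, DifferentiableAt ℝ (f k) x) (hg : ∀ k, DifferentiableAt ℝ (g k) x) :
    pd m (fun y => ∑ k, f k y * g k y) x
      = ∑ k, (pd m (f k) x * g k x + f k x * pd m (g k) x) := by
  have h : HasFDerivAt (fun y => ∑ k, f k y * g k y)
      (∑ k, (f k x • fderiv ℝ (g k) x + g k x • fderiv ℝ (f k) x)) x :=
    HasFDerivAt.fun_sum fun k _ => (hf k).hasFDerivAt.mul (hg k).hasFDerivAt
  unfold pd
  rw [h.fderiv]
  simp only [_root_.sum_apply, _root_.add_apply,
    _root_.smul_apply, smul_eq_mul]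
  refine Finset.sum_congr rfl fun k _ => ?_
  ring

theorem statement13 (n : ℕ) (hn : 2 ≤ n) [NeZero n]
    (U : Set (Fin n → ℝ)) (hU : IsOpen U)
    (a : (Fin n → ℝ) → Fin n → Fin n → ℝ)
    (b : (Fin n → ℝ) → Fin n → Fin n → Fin n → ℝ)
    (ha : ∀ i k, ContDiffOn ℝ (⊤ : ℕ∞) (fun x => a x i k) U)
    (hb : ∀ i j m, ContDiffOn ℝ (⊤ : ℕ∞) (fun x => b x i j m) U)
    (hskew : ∀ x ∈ U, ∀ i j m, b x i j m = -b x j i m)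
    (hstruct1 : ∀ x ∈ U, ∀ i l m,
      pd l (fun y => a y i m) x - pd m (fun y => a y i l) x =
        ∑ j, (a x j l * b x j i m - a x j m * b x j i l))
    (hstruct2 : ∀ x ∈ U, ∀ i j l m,
      pd l (fun y => b y i j m) x - pd m (fun y => b y i j l) x =
        (∑ k, (b x i k l * b x k j m - b x i k m * b x k j l))
          + a x i l * a x j m - a x i m * a x j l)
    (L : (Fin n → ℝ) → Matrix (Fin n) (Fin n) ℝ)
    (hL : ∀ i k, ContDiffOn ℝ (⊤ : ℕ∞) (fun x => L x i k) U)
    (horth : ∀ x ∈ U, L x * (L x)ᵀ = 1)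
    (heqA : ∀ x ∈ U, ∀ m : Fin n, ∀ i : Fin n, i ≠ 0 →
      (∑ k, pd m (fun y => L y 0 k) x * L x i k)
        + (∑ k, ∑ l, L x 0 k * b x k l m * L x i l)
        + (∑ k, L x i k * a x k m) = 0)
    (heqB : ∀ x ∈ U, ∀ m : Fin n, ∀ i j : Fin n, i ≠ j → i ≠ 0 → j ≠ 0 →
      (∑ k, pd m (fun y => L y i k) x * L x j k)
        + (∑ k, ∑ l, L x i k * b x k l m * L x j l) = 0) :
    ∀ x ∈ U, ∀ l m : Fin n,
      pd l (fun y => ∑ k, L y 0 k * a y k m) x =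
        pd m (fun y => ∑ k, L y 0 k * a y k l) x := by
  intro x hx l m
  have dL : ∀ i k, DifferentiableAt ℝ (fun y => L y i k) x := fun i k =>
    ((hL i k).contDiffAt (hU.mem_nhds hx)).differentiableAt (by simp)
  have da : ∀ i k, DifferentiableAt ℝ (fun y => a y i k) x := fun i k =>
    ((ha i k).contDiffAt (hU.mem_nhds hx)).differentiableAt (by simp)
  have h0 : ∀ q, ∑ k, pd q (fun y => L y 0 k) x * L x 0 k = 0 := by
    intro q
    have h1 := s13_pd_sum q (fun k y => L y 0 k) (fun k y => L y 0 k) x (dL 0) (dL 0)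
    have h2 : (fun y => ∑ k, L y 0 k * L y 0 k) =ᶠ[nhds x] fun _ => (1 : ℝ) := by
      filter_upwards [hU.mem_nhds hx] with y hy
      have := congrFun (congrFun (horth y hy) 0) 0
      rw [Matrix.mul_apply] at this
      simpa using this
    have h3 : pd q (fun y => ∑ k, L y 0 k * L y 0 k) x = 0 := by
      unfold pd
      rw [h2.fderiv_eq]; simp
    rw [h3, Finset.sum_add_distrib] at h1
    have h4 : ∑ k, L x 0 k * pd q (fun y => L y 0 k) x
        = ∑ k, pd q (fun y => L y 0 k) x * L x 0 k :=
      Finset.sum_congr rfl fun k _ => mul_comm _ _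
    linarith
  have key : ∀ q p, pd q (fun y => L y 0 p) x = - (∑ k, L x 0 k * b x k p q) - a x p q
      + L x 0 p * ∑ k, L x 0 k * a x k q := fun q p =>
    s13_row (L x) (horth x hx) (fun k => pd q (fun y => L y 0 k) x) (fun k => a x k q)
      (fun i j => b x i j q) (fun i j => hskew x hx i j q) (h0 q) (heqA x hx q) p
  rw [s13_pd_sum l (fun k y => L y 0 k) (fun k y => a y k m) x (dL 0) (fun k => da k m),
    s13_pd_sum m (fun k y => L y 0 k) (fun k y => a y k l) x (dL 0) (fun k => da k l),
    ← sub_eq_zero, ← Finset.sum_sub_distrib]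
  have e1 : ∀ k, (pd l (fun y => L y 0 k) x * a x k m + L x 0 k * pd l (fun y => a y k m) x)
      - (pd m (fun y => L y 0 k) x * a x k l + L x 0 k * pd m (fun y => a y k l) x)
      = ((∑ j, L x 0 j * a x j l) * (L x 0 k * a x k m)
        - (∑ j, L x 0 j * a x j m) * (L x 0 k * a x k l))
        + ((∑ j, L x 0 j * (b x j k m * a x k l - b x j k l * a x k m))
        - ∑ j, L x 0 k * (b x k j m * a x j l - b x k j l * a x j m)) := by
    intro k
    have s := hstruct1 x hx k l m
    have s' : ∑ j, L x 0 k * (b x k j m * a x j l - b x k j l * a x j m)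
        = - (L x 0 k * ∑ j, (a x j l * b x j k m - a x j m * b x j k l)) := by
      rw [Finset.mul_sum, ← Finset.sum_neg_distrib]
      refine Finset.sum_congr rfl fun j _ => ?_
      rw [hskew x hx k j m, hskew x hx k j l]; ring
    have s2 : ∑ j, L x 0 j * (b x j k m * a x k l - b x j k l * a x k m)
        = (∑ j, L x 0 j * b x j k m) * a x k l - (∑ j, L x 0 j * b x j k l) * a x k m := by
      rw [Finset.sum_mul, Finset.sum_mul, ← Finset.sum_sub_distrib]
      refine Finset.sum_congr rfl fun j _ => ?_
      ring
    rw [s', s2, ← s, key l k, key m k]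
    ring
  rw [Finset.sum_congr rfl fun k _ => e1 k, Finset.sum_add_distrib, Finset.sum_sub_distrib,
    Finset.sum_sub_distrib, ← Finset.mul_sum, ← Finset.mul_sum]
  rw [Finset.sum_comm (f := fun k j => L x 0 j * (b x j k m * a x k l - b x j k l * a x k m))]
  ring
end
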